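/- arXiv:2211.17069 — 4 statements merged into one kernel-verified Lean document; each statement's English description precedes it below -/
import Mathlib

section
/- For any pair of convex bodies K, L in ℝ^n and any θ in [0,1], the θ-convolution body satisfies |K +_θ L|^(1/n) ≥ (1 − θ^(1/n))(|K|^(1/n) + |L|^(1/n)). -/
open MeasureTheory Set Pointwise

variable {n : ℕ}

/-- The generalized covariogram `z ↦ |K ∩ (z - L)|`. -/
noncomputable def covar (K L : Set (EuclideanSpace ℝ (Fin n)))
    (z : EuclideanSpace ℝ (Fin n)) : ℝ :=
  (volume {x | x ∈ K ∧ z - x ∈ L}).toReal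

/-- `M(K,L) = max_z |K ∩ (z - L)|`. -/
noncomputable def Mmax (K L : Set (EuclideanSpace ℝ (Fin n))) : ℝ :=
  ⨆ z, covar K L z

/-- The θ-convolution body. -/
noncomputable def thetaConv (K L : Set (EuclideanSpace ℝ (Fin n))) (θ : ℝ) :
    Set (EuclideanSpace ℝ (Fin n)) :=
  {z ∈ K + L | θ * Mmax K L ≤ covar K L z}

/-- A convex body: compact, convex, with nonempty interior. -/
def IsConvexBody (K : Set (EuclideanSpace ℝ (Fin n))) : Prop :=
  IsCompact K ∧ Convex ℝ K ∧ (interior K).Nonempty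

lemma bm_dim_one {A B C : Set ℝ} (hA : MeasurableSet A) (hB : MeasurableSet B)
    (hA0 : A.Nonempty) (hB0 : B.Nonempty) (h : ∀ a ∈ A, ∀ b ∈ B, a + b ∈ C) :
    volume A + volume B ≤ volume C := by
  have key : ∀ K₁ : Set ℝ, K₁ ⊆ A → IsCompact K₁ → ∀ K₂ : Set ℝ, K₂ ⊆ B → IsCompact K₂ →
      volume K₁ + volume K₂ ≤ volume C := by
    intro K₁ hK₁ c₁ K₂ hK₂ c₂
    rcases K₁.eq_empty_or_nonempty with rfl | n₁
    · obtain ⟨a, ha⟩ := hA0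
      rw [measure_empty, zero_add]
      rw [← measure_preimage_add volume a C]
      exact measure_mono fun b hb => h a ha b (hK₂ hb)
    rcases K₂.eq_empty_or_nonempty with rfl | n₂
    · obtain ⟨b, hb⟩ := hB0
      rw [measure_empty, add_zero]
      rw [← measure_preimage_add_right volume b C]
      exact measure_mono fun a ha => h a (hK₁ ha) b hb
    obtain ⟨a, ha, hamax⟩ := c₁.exists_isGreatest n₁
    obtain ⟨b, hb, hbmin⟩ := c₂.exists_isLeast n₂
    have e1 : volume K₁ = volume ((fun x => x + (-b)) ⁻¹' K₁) :=
      (measure_preimage_add_right volume (-b) K₁).symm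
    have e2 : volume K₂ = volume ((fun x => -a + x) ⁻¹' K₂) :=
      (measure_preimage_add volume (-a) K₂).symm
    rw [e1, e2, ← measure_union₀]
    · apply measure_mono
      rintro x (hx | hx)
      · have := h _ (hK₁ hx) b (hK₂ hb)
        simpa using this
      · have := h a (hK₁ ha) _ (hK₂ hx)
        simpa using this
    · exact (c₂.measurableSet.preimage (measurable_const_add (-a))).nullMeasurableSet
    · refine measure_mono_null (t := {a + b}) ?_ (by simp)
      rintro x ⟨hx1, hx2⟩
      have h1 := hamax hx1
      have h2 := hbmin hx2
      simp only [mem_singleton_iff]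
      linarith
  rw [hA.measure_eq_iSup_isCompact, hB.measure_eq_iSup_isCompact]
  simp only [iSup_and']
  refine ENNReal.biSup_add_biSup_le' ⟨∅, by simp⟩ ⟨∅, by simp⟩ ?_
  rintro K₁ ⟨h1, h2⟩ K₂ ⟨h3, h4⟩
  exact key K₁ h1 h2 K₂ h3 h4

lemma layer_cake_le_one {f : ℝ → ENNReal} (hf : Measurable f) (h1 : ∀ x, f x ≤ 1) :
    ∫⁻ x, f x = ∫⁻ t in Ioi (0:ℝ), volume {x | ENNReal.ofReal t < f x} := by
  have hne : ∀ x, f x ≠ ⊤ := fun x => ne_top_of_le_ne_top ENNReal.one_ne_top (h1 x)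
  have := lintegral_eq_lintegral_meas_lt (f := fun x => (f x).toReal) volume
    (Filter.Eventually.of_forall fun x => ENNReal.toReal_nonneg) hf.ennreal_toReal.aemeasurable
  simp only [ENNReal.ofReal_toReal (hne _)] at this
  rw [this]
  refine setLIntegral_congr_fun measurableSet_Ioi fun t ht => ?_
  simp only [ENNReal.ofReal_lt_iff_lt_toReal (le_of_lt ht) (hne _)]

lemma amgm_ennreal {u v : ℝ} (hu : 0 < u) (hv : 0 < v) (huv : u + v = 1) (a b : ENNReal) :
    a ^ u * b ^ v ≤ ENNReal.ofReal u * a + ENNReal.ofReal v * b := by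
  by_cases ha : a = ⊤
  · subst ha
    rw [ENNReal.mul_top (by simpa using hu)]; simp
  by_cases hb : b = ⊤
  · subst hb
    rw [ENNReal.mul_top (a := ENNReal.ofReal v) (by simpa using hv)]; simp
  lift a to NNReal using ha
  lift b to NNReal using hb
  have := NNReal.geom_mean_le_arith_mean2_weighted u.toNNReal v.toNNReal a b
    (by rw [← Real.toNNReal_add hu.le hv.le, huv]; simp)
  rw [Real.coe_toNNReal _ hu.le, Real.coe_toNNReal _ hv.le] at this
  rw [← ENNReal.coe_rpow_of_nonneg _ hu.le, ← ENNReal.coe_rpow_of_nonneg _ hv.le]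
  unfold ENNReal.ofReal
  exact_mod_cast this

lemma pl_one_normalized {u v : ℝ} (hu : 0 < u) (hv : 0 < v) (huv : u + v = 1)
    {f g h : ℝ → ENNReal} (hf : Measurable f) (hg : Measurable g) (hh : Measurable h)
    (f1 : ⨆ x, f x = 1) (g1 : ⨆ x, g x = 1)
    (H : ∀ x y, f x ^ u * g y ^ v ≤ h (u * x + v * y)) :
    (∫⁻ x, f x) ^ u * (∫⁻ x, g x) ^ v ≤ ∫⁻ x, h x := by
  have fl : ∀ x, f x ≤ 1 := fun x => f1 ▸ le_iSup f x
  have gl : ∀ x, g x ≤ 1 := fun x => g1 ▸ le_iSup g x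
  set k : ℝ → ENNReal := fun x => min (h x) 1 with hk
  have hkm : Measurable k := hh.min measurable_const
  have kl : ∀ x, k x ≤ 1 := fun x => min_le_right _ _
  have Hk : ∀ x y, f x ^ u * g y ^ v ≤ k (u * x + v * y) := fun x y =>
    le_min (H x y) (mul_le_one' (ENNReal.rpow_le_one (fl x) hu.le) (ENNReal.rpow_le_one (gl y) hv.le))
  refine (amgm_ennreal hu hv huv _ _).trans (le_trans ?_ (lintegral_mono fun x => min_le_left (h x) 1))
  change _ ≤ ∫⁻ x, k x
  rw [layer_cake_le_one hf fl, layer_cake_le_one hg gl, layer_cake_le_one hkm kl]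
  have hmeas : ∀ F : ℝ → ENNReal, Measurable fun t : ℝ => volume {x | ENNReal.ofReal t < F x} := by
    intro F
    refine Antitone.measurable ?_
    intro s t hst
    exact measure_mono fun x hx => lt_of_le_of_lt (ENNReal.ofReal_le_ofReal hst) hx
  rw [← lintegral_const_mul _ (hmeas f), ← lintegral_const_mul _ (hmeas g),
    ← lintegral_add_left ((hmeas f).const_mul _)]
  refine setLIntegral_mono' measurableSet_Ioi fun t ht => ?_
  have ht0 : (0:ℝ) < t := ht
  by_cases ht1 : 1 ≤ t
  · have e : ∀ F : ℝ → ENNReal, (∀ x, F x ≤ 1) → {x | ENNReal.ofReal t < F x} = ∅ := by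
      intro F hF
      ext x
      simp only [mem_ofPred_eq, mem_empty_iff_false, iff_false, not_lt]
      exact (hF x).trans (by simpa using ht1)
    rw [e f fl, e g gl]; simp
  push Not at ht1
  have htl : ENNReal.ofReal t < 1 := by simpa using ht1
  obtain ⟨x0, hx0⟩ := lt_iSup_iff.1 (f1 ▸ htl)
  obtain ⟨y0, hy0⟩ := lt_iSup_iff.1 (g1 ▸ htl)
  have := bm_dim_one (A := u • {x | ENNReal.ofReal t < f x}) (B := v • {x | ENNReal.ofReal t < g x})
    (C := {x | ENNReal.ofReal t < k x})
    ((measurableSet_lt measurable_const hf).const_smul₀ u)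
    ((measurableSet_lt measurable_const hg).const_smul₀ v)
    ⟨_, smul_mem_smul_set hx0⟩ ⟨_, smul_mem_smul_set hy0⟩ ?_
  · rw [Measure.addHaar_smul, Measure.addHaar_smul] at this
    simpa [abs_of_pos hu, abs_of_pos hv] using this
  · rintro _ ⟨x, hx, rfl⟩ _ ⟨y, hy, rfl⟩
    simp only [mem_ofPred_eq, smul_eq_mul] at *
    refine lt_of_lt_of_le ?_ (Hk x y)
    have e : ENNReal.ofReal t = ENNReal.ofReal t ^ u * ENNReal.ofReal t ^ v := by
      rw [← ENNReal.rpow_add _ _ (by simpa using ht0) ENNReal.ofReal_ne_top, huv, ENNReal.rpow_one]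
    rw [e]
    exact ENNReal.mul_lt_mul (ENNReal.rpow_lt_rpow hx hu) (ENNReal.rpow_lt_rpow hy hv)

lemma pl_one_bdd {u v : ℝ} (hu : 0 < u) (hv : 0 < v) (huv : u + v = 1)
    {f g h : ℝ → ENNReal} (hf : Measurable f) (hg : Measurable g) (hh : Measurable h)
    (f1 : ⨆ x, f x ≠ ⊤) (g1 : ⨆ x, g x ≠ ⊤)
    (H : ∀ x y, f x ^ u * g y ^ v ≤ h (u * x + v * y)) :
    (∫⁻ x, f x) ^ u * (∫⁻ x, g x) ^ v ≤ ∫⁻ x, h x := by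
  by_cases f0 : ⨆ x, f x = 0
  · have : ∀ x, f x = 0 := by simpa using f0
    simp [this, hu]
  by_cases g0 : ⨆ x, g x = 0
  · have : ∀ x, g x = 0 := by simpa using g0
    simp [this, hv]
  set a := ⨆ x, f x with ha
  set b := ⨆ x, g x with hb
  have hai : a⁻¹ ≠ ⊤ := by simpa using f0
  have hbi : b⁻¹ ≠ ⊤ := by simpa using g0
  have hai0 : a⁻¹ ≠ 0 := by simpa using f1
  have hbi0 : b⁻¹ ≠ 0 := by simpa using g1
  set c := a⁻¹ ^ u * b⁻¹ ^ v with hc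
  have hc0 : c ≠ 0 := by
    simp [hc, f1, g1, f0, g0, hu.le, hv.le]
  have hct : c ≠ ⊤ := ENNReal.mul_ne_top (ENNReal.rpow_ne_top_of_nonneg hu.le hai)
    (ENNReal.rpow_ne_top_of_nonneg hv.le hbi)
  have := pl_one_normalized hu hv huv (f := fun x => a⁻¹ * f x) (g := fun x => b⁻¹ * g x)
    (h := fun x => c * h x) (hf.const_mul _) (hg.const_mul _) (hh.const_mul _)
    (by rw [← ENNReal.mul_iSup]; exact ENNReal.inv_mul_cancel f0 f1)
    (by rw [← ENNReal.mul_iSup]; exact ENNReal.inv_mul_cancel g0 g1)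
    (fun x y => by
      rw [ENNReal.mul_rpow_of_nonneg _ _ hu.le, ENNReal.mul_rpow_of_nonneg _ _ hv.le,
        mul_mul_mul_comm]
      exact mul_le_mul_right (H x y) c)
  rw [lintegral_const_mul _ hf, lintegral_const_mul _ hg, lintegral_const_mul _ hh,
    ENNReal.mul_rpow_of_nonneg _ _ hu.le, ENNReal.mul_rpow_of_nonneg _ _ hv.le,
    mul_mul_mul_comm] at this
  exact (ENNReal.mul_le_mul_iff_right hc0 hct).1 this

lemma tendsto_lintegral_min {f : ℝ → ENNReal} (hf : Measurable f) :
    Filter.Tendsto (fun N : ℕ => ∫⁻ x, min (f x) N) Filter.atTop (nhds (∫⁻ x, f x)) := by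
  refine lintegral_tendsto_of_tendsto_of_monotone
    (fun N => (hf.min measurable_const).aemeasurable) ?_ ?_
  · refine Filter.Eventually.of_forall fun x i j hij => ?_
    exact min_le_min le_rfl (by exact_mod_cast hij)
  · refine Filter.Eventually.of_forall fun x => ?_
    have := (tendsto_const_nhds (x := f x)).min ENNReal.tendsto_nat_nhds_top
    simpa using this

lemma pl_one {u v : ℝ} (hu : 0 < u) (hv : 0 < v) (huv : u + v = 1)
    {f g h : ℝ → ENNReal} (hf : Measurable f) (hg : Measurable g) (hh : Measurable h)
    (H : ∀ x y, f x ^ u * g y ^ v ≤ h (u * x + v * y)) :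
    (∫⁻ x, f x) ^ u * (∫⁻ x, g x) ^ v ≤ ∫⁻ x, h x := by
  by_cases f0 : ∫⁻ x, f x = 0
  · simp [f0, hu]
  by_cases g0 : ∫⁻ x, g x = 0
  · simp [g0, hv]
  have tf := ((ENNReal.continuous_rpow_const (y := u)).tendsto _).comp (tendsto_lintegral_min hf)
  have tg := ((ENNReal.continuous_rpow_const (y := v)).tendsto _).comp (tendsto_lintegral_min hg)
  refine le_of_tendsto (ENNReal.Tendsto.mul tf (Or.inl ?_) tg (Or.inl ?_))
    (Filter.Eventually.of_forall fun N => ?_)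
  · simp [f0, hu.le, hu.not_gt]
  · simp [g0, hv.le, hv.not_gt]
  · have bd : ∀ F : ℝ → ENNReal, ⨆ x, min (F x) (N : ENNReal) ≠ ⊤ := fun F =>
      ne_top_of_le_ne_top (ENNReal.natCast_ne_top N) (iSup_le fun x => min_le_right _ _)
    refine pl_one_bdd hu hv huv (hf.min measurable_const) (hg.min measurable_const) hh
      (bd f) (bd g) fun x y => le_trans ?_ (H x y)
    gcongr <;> exact min_le_left _ _

lemma pl_pi {u v : ℝ} (hu : 0 < u) (hv : 0 < v) (huv : u + v = 1) (m : ℕ) :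
    ∀ {f g h : (Fin m → ℝ) → ENNReal}, Measurable f → Measurable g → Measurable h →
    (∀ x y, f x ^ u * g y ^ v ≤ h (u • x + v • y)) →
    (∫⁻ x, f x) ^ u * (∫⁻ x, g x) ^ v ≤ ∫⁻ x, h x := by
  induction m with
  | zero =>
    intro f g h hf hg hh H
    have e : ∀ F : (Fin 0 → ℝ) → ENNReal, ∫⁻ x, F x = F 0 := by
      intro F
      rw [Measure.volume_pi_eq_dirac (0 : Fin 0 → ℝ), lintegral_dirac]
    rw [e, e, e]
    simpa using H 0 0
  | succ m ih =>
    intro f g h hf hg hh H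
    let E := (MeasurableEquiv.piFinSuccAbove (fun _ : Fin (m+1) => ℝ) 0)
    have hE : MeasurePreserving E.symm (volume.prod volume) volume :=
      (volume_preserving_piFinSuccAbove (fun _ : Fin (m+1) => ℝ) 0).symm E
    have lin : ∀ (x y : ℝ) (p q : Fin m → ℝ),
        E.symm (u * x + v * y, u • p + v • q) = u • E.symm (x, p) + v • E.symm (y, q) := by
      intro x y p q
      ext i
      refine Fin.cases ?_ (fun j => ?_) i <;> simp [E, MeasurableEquiv.piFinSuccAbove]
    have e : ∀ F : (Fin (m+1) → ℝ) → ENNReal, Measurable F →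
        ∫⁻ x, F x = ∫⁻ x : ℝ, ∫⁻ p : Fin m → ℝ, F (E.symm (x, p)) := by
      intro F hF
      rw [← hE.lintegral_comp hF]
      exact lintegral_prod (fun z => F (E.symm z)) (hF.comp E.symm.measurable).aemeasurable
    have ms : ∀ F : (Fin (m+1) → ℝ) → ENNReal, Measurable F →
        Measurable fun x : ℝ => ∫⁻ p : Fin m → ℝ, F (E.symm (x, p)) := fun F hF =>
      (hF.comp E.symm.measurable).lintegral_prod_right'
    rw [e f hf, e g hg, e h hh]
    refine pl_one hu hv huv (ms f hf) (ms g hg) (ms h hh) fun x y => ?_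
    have sec : ∀ (F : (Fin (m+1) → ℝ) → ENNReal) (x : ℝ), Measurable F →
        Measurable fun p : Fin m → ℝ => F (E.symm (x, p)) := fun F x hF =>
      hF.comp (E.symm.measurable.comp measurable_prodMk_left)
    refine ih (sec f x hf) (sec g y hg) (sec h _ hh) fun p q => ?_
    rw [lin]
    exact H _ _

lemma bm_mul {u v : ℝ} (hu : 0 < u) (hv : 0 < v) (huv : u + v = 1) (m : ℕ)
    {A B C : Set (EuclideanSpace ℝ (Fin m))} (hA : MeasurableSet A) (hB : MeasurableSet B)
    (hC : MeasurableSet C) (H : ∀ x ∈ A, ∀ y ∈ B, u • x + v • y ∈ C) :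
    volume A ^ u * volume B ^ v ≤ volume C := by
  have mp := PiLp.volume_preserving_toLp (Fin m)
  have e : ∀ S : Set (EuclideanSpace ℝ (Fin m)), MeasurableSet S → volume S =
      ∫⁻ x : Fin m → ℝ, (WithLp.toLp 2 ⁻¹' S).indicator 1 x := by
    intro S hS
    rw [lintegral_indicator_one (mp.measurable hS), mp.measure_preimage hS.nullMeasurableSet]
  have ms : ∀ S : Set (EuclideanSpace ℝ (Fin m)), MeasurableSet S →
      Measurable ((WithLp.toLp 2 ⁻¹' S).indicator (1 : (Fin m → ℝ) → ENNReal)) := fun S hS =>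
    measurable_one.indicator (mp.measurable hS)
  rw [e A hA, e B hB, e C hC]
  refine pl_pi hu hv huv m (ms A hA) (ms B hB) (ms C hC) fun x y => ?_
  by_cases hx : WithLp.toLp 2 x ∈ A
  · by_cases hy : WithLp.toLp 2 y ∈ B
    · have := H _ hx _ hy
      have hz : u • x + v • y ∈ (WithLp.toLp 2 ⁻¹' C : Set (Fin m → ℝ)) := by
        simpa using this
      rw [indicator_of_mem hz]
      simp [indicator, hx, hy]
    · simp [indicator, hy, hv]
  · simp [indicator, hx, hu]

lemma bm_root (hn : 0 < n) {A B : Set (EuclideanSpace ℝ (Fin n))}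
    (hA : IsCompact A) (hB : IsCompact B) (pA : 0 < volume A) (pB : 0 < volume B) :
    (volume A).toReal ^ ((1:ℝ)/n) + (volume B).toReal ^ ((1:ℝ)/n) ≤
      (volume (A + B)).toReal ^ ((1:ℝ)/n) := by
  have rA : 0 < (volume A).toReal := ENNReal.toReal_pos pA.ne' hA.measure_lt_top.ne
  have rB : 0 < (volume B).toReal := ENNReal.toReal_pos pB.ne' hB.measure_lt_top.ne
  have hC : IsCompact (A + B) := hA.add hB
  set a := (volume A).toReal ^ ((1:ℝ)/n) with ha
  set b := (volume B).toReal ^ ((1:ℝ)/n) with hb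
  have a0 : 0 < a := Real.rpow_pos_of_pos rA _
  have b0 : 0 < b := Real.rpow_pos_of_pos rB _
  have an : a ^ n = (volume A).toReal := by
    rw [ha, one_div, Real.rpow_inv_natCast_pow rA.le hn.ne']
  have bn : b ^ n = (volume B).toReal := by
    rw [hb, one_div, Real.rpow_inv_natCast_pow rB.le hn.ne']
  have vol1 : ∀ (S : Set (EuclideanSpace ℝ (Fin n))) (c : ℝ), IsCompact S → 0 < c →
      c ^ n = (volume S).toReal → volume (c⁻¹ • S) = 1 := by
    intro S c hS hc hcn
    rw [Measure.addHaar_smul, finrank_euclideanSpace_fin, abs_of_pos (by positivity),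
      ← ENNReal.ofReal_toReal hS.measure_lt_top.ne, ← hcn, ← ENNReal.ofReal_mul (by positivity),
      ← mul_pow, inv_mul_cancel₀ hc.ne']
    simp
  have s0 : 0 < a + b := by positivity
  have key := bm_mul (u := a / (a + b)) (v := b / (a + b)) (by positivity) (by positivity)
    (by field_simp) n (A := a⁻¹ • A) (B := b⁻¹ • B) (C := (a + b)⁻¹ • (A + B))
    (hA.smul _).measurableSet (hB.smul _).measurableSet (hC.smul _).measurableSet (by
      rintro _ ⟨x, hx, rfl⟩ _ ⟨y, hy, rfl⟩
      refine ⟨x + y, add_mem_add hx hy, ?_⟩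
      simp only [smul_smul, smul_add]
      congr 2 <;> field_simp)
  rw [vol1 A a hA a0 an, vol1 B b hB b0 bn, ENNReal.one_rpow, ENNReal.one_rpow, one_mul,
    Measure.addHaar_smul, finrank_euclideanSpace_fin, abs_of_pos (by positivity),
    ← ENNReal.ofReal_toReal hC.measure_lt_top.ne, ← ENNReal.ofReal_mul (by positivity),
    ENNReal.one_le_ofReal, inv_pow, inv_mul_eq_div, one_le_div (by positivity)] at key
  calc a + b = ((a + b) ^ n) ^ ((1:ℝ)/n) := by
        rw [one_div, Real.pow_rpow_inv_natCast s0.le hn.ne']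
    _ ≤ _ := by gcongr

lemma covar_combine {K L : Set (EuclideanSpace ℝ (Fin n))} (hK : IsConvexBody K)
    (hL : IsConvexBody L) {s : ℝ} (hs0 : 0 ≤ s) (hs1 : s ≤ 1)
    {w z : EuclideanSpace ℝ (Fin n)} (hw : w ∈ K + L) :
    s ^ n * covar K L z ≤ covar K L ((1 - s) • w + s • z) := by
  obtain ⟨a, ha, b, hb, rfl⟩ := hw
  have hfin : volume {x | x ∈ K ∧ ((1 - s) • (a + b) + s • z) - x ∈ L} ≠ ⊤ :=
    measure_ne_top_of_subset (fun x hx => hx.1) hK.1.measure_lt_top.ne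
  have hsub : (fun x => (1 - s) • a + x) '' (s • {x | x ∈ K ∧ z - x ∈ L}) ⊆
      {x | x ∈ K ∧ ((1 - s) • (a + b) + s • z) - x ∈ L} := by
    rintro _ ⟨_, ⟨y, ⟨hy1, hy2⟩, rfl⟩, rfl⟩
    refine ⟨hK.2.1 ha hy1 (by linarith) hs0 (by ring), ?_⟩
    have := hL.2.1 hb hy2 (by linarith : 0 ≤ 1 - s) hs0 (by ring)
    convert this using 1
    simp only
    module
  have h1 := ENNReal.toReal_mono hfin (measure_mono hsub)
  rw [image_add_left, measure_preimage_add, Measure.addHaar_smul, finrank_euclideanSpace_fin,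
    ENNReal.toReal_mul, ENNReal.toReal_ofReal (abs_nonneg _), abs_of_nonneg (by positivity)] at h1
  exact h1

lemma covar_le {K L : Set (EuclideanSpace ℝ (Fin n))} (hK : IsConvexBody K) :
    BddAbove (range (covar K L)) := by
  refine ⟨(volume K).toReal, ?_⟩
  rintro _ ⟨z, rfl⟩
  exact ENNReal.toReal_mono hK.1.measure_lt_top.ne (measure_mono fun x hx => hx.1)

lemma body_pos {K : Set (EuclideanSpace ℝ (Fin n))} (hK : IsConvexBody K) : 0 < volume K :=
  Measure.measure_pos_of_nonempty_interior volume hK.2.2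

lemma thetaConv_aux (hn : 0 < n) (K L : Set (EuclideanSpace ℝ (Fin n)))
    (hK : IsConvexBody K) (hL : IsConvexBody L) (θ : ℝ) (hθ0 : 0 ≤ θ) (s : ℝ)
    (hs0 : 0 < s) (hs1 : s ≤ 1) (hs : θ < s ^ n) :
    (1 - s) * ((volume K).toReal ^ ((1:ℝ)/n) + (volume L).toReal ^ ((1:ℝ)/n)) ≤
      (volume (thetaConv K L θ)).toReal ^ ((1:ℝ)/n) := by
  have hsum : IsCompact (K + L) := hK.1.add hL.1
  obtain ⟨z, hzKL, hz⟩ : ∃ z, z ∈ K + L ∧ θ * Mmax K L ≤ s ^ n * covar K L z := by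
    have cnn : ∀ z, 0 ≤ covar K L z := fun z => ENNReal.toReal_nonneg
    have Mnn : 0 ≤ Mmax K L := Real.iSup_nonneg cnn
    have hsn : 0 < s ^ n := by positivity
    rcases Mnn.eq_or_lt with hM | hM
    · obtain ⟨a, ha⟩ := hK.2.2
      obtain ⟨b, hb⟩ := hL.2.2
      refine ⟨a + b, add_mem_add (interior_subset ha) (interior_subset hb), ?_⟩
      rw [← hM, mul_zero]
      exact mul_nonneg hsn.le (cnn _)
    · have h1 : θ * Mmax K L / s ^ n < ⨆ z, covar K L z := by
        rw [div_lt_iff₀ hsn, mul_comm]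
        exact mul_lt_mul_of_pos_left hs hM
      obtain ⟨z, hz⟩ := exists_lt_of_lt_ciSup h1
      refine ⟨z, ?_, ?_⟩
      · have hp : 0 < covar K L z := lt_of_le_of_lt (by positivity) hz
        have hne : ({x | x ∈ K ∧ z - x ∈ L} : Set (EuclideanSpace ℝ (Fin n))).Nonempty := by
          rw [nonempty_iff_ne_empty]
          intro h0
          simp [covar, h0] at hp
        obtain ⟨x, hx1, hx2⟩ := hne
        exact ⟨x, hx1, z - x, hx2, by simp⟩
      · rw [div_lt_iff₀ hsn] at hz
        linarith
  have hsub : (fun x => s • z + x) '' ((1 - s) • (K + L)) ⊆ thetaConv K L θ := by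
    rintro _ ⟨_, ⟨w, hw, rfl⟩, rfl⟩
    simp only
    rw [add_comm]
    refine ⟨?_, hz.trans (covar_combine hK hL hs0.le hs1 hw)⟩
    exact (hK.2.1.add hL.2.1) hw hzKL (by linarith) hs0.le (by ring)
  have hfin : volume (thetaConv K L θ) ≠ ⊤ :=
    measure_ne_top_of_subset (fun x hx => hx.1) hsum.measure_lt_top.ne
  have h1 := ENNReal.toReal_mono hfin (measure_mono hsub)
  have hs1' : 0 ≤ 1 - s := by linarith
  rw [image_add_left, measure_preimage_add, Measure.addHaar_smul, finrank_euclideanSpace_fin,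
    ENNReal.toReal_mul, ENNReal.toReal_ofReal (abs_nonneg _), abs_of_nonneg (by positivity)] at h1
  calc _ ≤ (1 - s) * (volume (K + L)).toReal ^ ((1:ℝ)/n) :=
        mul_le_mul_of_nonneg_left (bm_root hn hK.1 hL.1 (body_pos hK) (body_pos hL)) hs1'
    _ = ((1 - s) ^ n * (volume (K + L)).toReal) ^ ((1:ℝ)/n) := by
        rw [Real.mul_rpow (by positivity) (by positivity), one_div,
          Real.pow_rpow_inv_natCast hs1' hn.ne']
    _ ≤ _ := by gcongr

theorem thetaConv_brunn_minkowski (hn : 0 < n) (K L : Set (EuclideanSpace ℝ (Fin n)))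
    (hK : IsConvexBody K) (hL : IsConvexBody L) (θ : ℝ) (hθ : θ ∈ Icc (0:ℝ) 1) :
    (volume (thetaConv K L θ)).toReal ^ ((1:ℝ)/n) ≥
      (1 - θ ^ ((1:ℝ)/n)) *
        ((volume K).toReal ^ ((1:ℝ)/n) + (volume L).toReal ^ ((1:ℝ)/n)) := by
  set C := (volume K).toReal ^ ((1:ℝ)/n) + (volume L).toReal ^ ((1:ℝ)/n) with hC
  obtain ⟨h0, h1⟩ := hθ
  set r := θ ^ ((1:ℝ)/n) with hr
  have r0 : 0 ≤ r := Real.rpow_nonneg h0 _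
  have rn : r ^ n = θ := by rw [hr, one_div, Real.rpow_inv_natCast_pow h0 hn.ne']
  have r1 : r ≤ 1 := Real.rpow_le_one h0 h1 (by positivity)
  rcases r1.eq_or_lt with r1 | r1
  · rw [r1, sub_self, zero_mul]
    positivity
  have ht : Filter.Tendsto (fun s : ℝ => (1 - s) * C) (nhdsWithin r (Ioi r))
      (nhds ((1 - r) * C)) :=
    (Continuous.tendsto (by fun_prop) r).mono_left nhdsWithin_le_nhds
  refine le_of_tendsto ht ?_
  filter_upwards [Ioo_mem_nhdsGT r1] with s hs
  refine thetaConv_aux hn K L hK hL θ h0 s (lt_of_le_of_lt r0 hs.1) hs.2.le ?_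
  rw [← rn]
  exact pow_lt_pow_left₀ hs.1 r0 hn.ne'
end

section
/- For any pair of convex bodies K, L in ℝ^n and any θ with (3/4)^n ≤ θ ≤ 1, one has |K +_θ L|^(1/n) ≥ (1/2)·binom(2n,n)^(1/n)·(1 − θ^(1/n))·(|K|^(1/n) + |L|^(1/n)). -/
open MeasureTheory Set Pointwise

variable {n : ℕ}

open scoped ENNReal in
theorem bmw_geom_arith (p q : ℝ) (hp : 0 < p) (hq : 0 < q) (hpq : p + q = 1) (x y : ℝ≥0∞) :
    x ^ p * y ^ q ≤ ENNReal.ofReal p * x + ENNReal.ofReal q * y := by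
  have hp' : ENNReal.ofReal p ≠ 0 := by simpa using hp
  have hq' : ENNReal.ofReal q ≠ 0 := by simpa using hq
  by_cases hx : x = ∞
  · simp [hx, hp', ENNReal.mul_top]
  by_cases hy : y = ∞
  · simp [hy, hq', ENNReal.mul_top]
  lift x to NNReal using hx
  lift y to NNReal using hy
  have := NNReal.geom_mean_le_arith_mean2_weighted ⟨p, hp.le⟩ ⟨q, hq.le⟩ x y
    (by ext; exact hpq)
  rw [ENNReal.ofReal_eq_coe_nnreal hp.le, ENNReal.ofReal_eq_coe_nnreal hq.le]
  rw [← ENNReal.coe_rpow_of_nonneg _ hp.le, ← ENNReal.coe_rpow_of_nonneg _ hq.le]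
  exact_mod_cast this


theorem bmw_vol_affine (p c : ℝ) (hp : 0 < p) (A : Set ℝ) :
    volume ((fun x => p * x + c) '' A) = ENNReal.ofReal p * volume A := by
  have : (fun x => p * x + c) '' A = (fun x => x + c) '' (p • A) := by
    rw [← Set.image_smul, Set.image_image]; rfl
  rw [this, Set.image_add_right, measure_preimage_add_right, Measure.addHaar_smul]
  simp [abs_of_pos hp]

/-- one-dimensional Brunn-Minkowski for compact sets -/
theorem bmw_one_compact (p q : ℝ) (hp : 0 < p) (hq : 0 < q) (A B C : Set ℝ)
    (hA : IsCompact A) (hB : IsCompact B) (hAn : A.Nonempty) (hBn : B.Nonempty)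
    (h : ∀ x ∈ A, ∀ y ∈ B, p * x + q * y ∈ C) :
    ENNReal.ofReal p * volume A + ENNReal.ofReal q * volume B ≤ volume C := by
  obtain ⟨a, haA, ha⟩ := hA.exists_isGreatest hAn
  obtain ⟨b, hbB, hb⟩ := hB.exists_isLeast hBn
  rw [← bmw_vol_affine p (q * b) hp A, ← bmw_vol_affine q (p * a) hq B, ← measure_union₀]
  · apply measure_mono
    rintro _ (⟨x, hx, rfl⟩ | ⟨y, hy, rfl⟩)
    · exact h x hx b hbB
    · simpa [add_comm] using h a haA y hy
  · exact (hB.image (by fun_prop)).measurableSet.nullMeasurableSet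
  · refine measure_mono_null (t := {p * a + q * b}) ?_ (by simp)
    rintro z ⟨⟨x, hx, rfl⟩, ⟨y, hy, h2⟩⟩
    have h3 : x ≤ a := ha hx
    have h4 : b ≤ y := hb hy
    simp only at h2 ⊢
    have h5 := mul_le_mul_of_nonneg_left h3 hp.le
    have h6 := mul_le_mul_of_nonneg_left h4 hq.le
    simp only [mem_singleton_iff]
    linarith

theorem bmw_one (p q : ℝ) (hp : 0 < p) (hq : 0 < q) (A B C : Set ℝ)
    (hA : MeasurableSet A) (hB : MeasurableSet B) (hAn : A.Nonempty) (hBn : B.Nonempty)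
    (h : ∀ x ∈ A, ∀ y ∈ B, p * x + q * y ∈ C) :
    ENNReal.ofReal p * volume A + ENNReal.ofReal q * volume B ≤ volume C := by
  obtain ⟨a, ha⟩ := hAn
  obtain ⟨b, hb⟩ := hBn
  have key : ∀ A' ⊆ A, IsCompact A' → ∀ B' ⊆ B, IsCompact B' →
      ENNReal.ofReal p * volume A' + ENNReal.ofReal q * volume B' ≤ volume C := by
    intro A' hA' hAc B' hB' hBc
    refine le_trans ?_ (bmw_one_compact p q hp hq (insert a A') (insert b B') C
      (hAc.insert a) (hBc.insert b) (by simp) (by simp) ?_)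
    · gcongr <;> simp
    · intro x hx y hy
      apply h
      · rcases hx with rfl | hx
        exacts [ha, hA' hx]
      · rcases hy with rfl | hy
        exacts [hb, hB' hy]
  rw [hA.measure_eq_iSup_isCompact, hB.measure_eq_iSup_isCompact]
  simp only [ENNReal.mul_iSup]
  refine ENNReal.biSup_add_biSup_le' (p := fun A' => A' ⊆ A) (q := fun B' => B' ⊆ B) ⟨∅, by simp⟩ ⟨∅, by simp⟩ ?_
  intro A' hA' B' hB'
  by_cases h1 : IsCompact A' <;> by_cases h2 : IsCompact B'
  · simpa [h1, h2] using key A' hA' h1 B' hB' h2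
  · simpa [h1, h2] using key A' hA' h1 ∅ (by simp) (by simp)
  · simpa [h1, h2] using key ∅ (by simp) (by simp) B' hB' h2
  · simp [h1, h2]

theorem bmw_layer (f : ℝ → ENNReal) (hf : Measurable f) (hf1 : ∀ x, f x ≤ 1) :
    ∫⁻ x, f x = ∫⁻ t in Ioo (0:ℝ) 1, volume {x | ENNReal.ofReal t < f x} := by
  have h0 : ∀ x, f x = ENNReal.ofReal (f x).toReal := fun x =>
    (ENNReal.ofReal_toReal ((hf1 x).trans_lt ENNReal.one_lt_top).ne).symm
  have h1 : ∫⁻ x, f x = ∫⁻ x, ENNReal.ofReal (f x).toReal := lintegral_congr h0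
  rw [h1, lintegral_eq_lintegral_meas_lt _ (by filter_upwards with x; simp)
    hf.ennreal_toReal.aemeasurable]
  have h2 : ∀ t : ℝ, 0 < t → {x | ENNReal.ofReal t < f x} = {x | t < (f x).toReal} := by
    intro t ht
    ext x
    simp only [mem_ofPred_eq]
    rw [ENNReal.ofReal_lt_iff_lt_toReal ht.le ((hf1 x).trans_lt ENNReal.one_lt_top).ne]
  have h3 : Ioi (0:ℝ) = Ioo 0 1 ∪ Ici 1 := by
    rw [Ioo_union_Ici_eq_Ioi]; norm_num
  rw [h3, lintegral_union measurableSet_Ici]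
  · have : ∫⁻ t in Ici (1:ℝ), volume {a | t < (f a).toReal} = 0 := by
      rw [setLIntegral_congr_fun (g := fun _ => 0) measurableSet_Ici]
      · simp
      · intro t ht
        have : {a | t < (f a).toReal} = ∅ := by
          ext x
          have : (f x).toReal ≤ 1 := ENNReal.toReal_le_of_le_ofReal (by norm_num) (by simpa using hf1 x)
          simp only [mem_Ici] at ht
          simp; linarith
        simp [this]
    rw [this, add_zero]
    apply setLIntegral_congr_fun measurableSet_Ioo
    intro t ht
    simp only [h2 t ht.1]
  · rw [Set.disjoint_left]; rintro x hx hx'; exact absurd hx.2 (not_lt.2 hx')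

theorem bmw_pl_norm (p q : ℝ) (hp : 0 < p) (hq : 0 < q) (hpq : p + q = 1) (f g h : ℝ → ENNReal)
    (hf : Measurable f) (hg : Measurable g) (hh : Measurable h)
    (hf1 : ∀ x, f x ≤ 1) (hg1 : ∀ x, g x ≤ 1)
    (hf2 : ∀ t < 1, ∃ x, t < f x) (hg2 : ∀ t < 1, ∃ x, t < g x)
    (H : ∀ x y, f x ^ p * g y ^ q ≤ h (p * x + q * y)) :
    ENNReal.ofReal p * (∫⁻ x, f x) + ENNReal.ofReal q * (∫⁻ x, g x) ≤ ∫⁻ x, h x := by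
  have e : ∫⁻ x, min (h x) 1 ≤ ∫⁻ x, h x := lintegral_mono (fun x => min_le_left _ _)
  refine le_trans ?_ e
  rw [bmw_layer f hf hf1, bmw_layer g hg hg1,
    bmw_layer (fun x => min (h x) 1) (hh.min measurable_const) (fun x => min_le_right _ _)]
  have mono : ∀ f : ℝ → ENNReal, Measurable fun t : ℝ => volume {x | ENNReal.ofReal t < f x} := by
    intro f
    apply Antitone.measurable
    intro s t hst
    apply measure_mono
    intro x hx
    exact lt_of_le_of_lt (ENNReal.ofReal_le_ofReal hst) hx
  rw [← lintegral_const_mul _ (mono f), ← lintegral_const_mul _ (mono g), ← lintegral_add_left]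
  swap
  · exact (mono f).const_mul _
  apply setLIntegral_mono' measurableSet_Ioo
  intro t ht
  have ht1 : ENNReal.ofReal t < 1 := by
    rw [← ENNReal.ofReal_one, ENNReal.ofReal_lt_ofReal_iff one_pos]; exact ht.2
  apply bmw_one p q hp hq _ _ _ (hf measurableSet_Ioi) (hg measurableSet_Ioi)
    (hf2 _ ht1) (hg2 _ ht1)
  intro x hx y hy
  refine lt_min ?_ ht1
  refine lt_of_lt_of_le ?_ (H x y)
  have ht0 : ENNReal.ofReal t ≠ 0 := by simpa using ht.1
  calc ENNReal.ofReal t = ENNReal.ofReal t ^ p * ENNReal.ofReal t ^ q := by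
        rw [← ENNReal.rpow_add _ _ ht0 ENNReal.ofReal_ne_top, hpq, ENNReal.rpow_one]
    _ < f x ^ p * g y ^ q := ENNReal.mul_lt_mul (ENNReal.rpow_lt_rpow hx hp) (ENNReal.rpow_lt_rpow hy hq)

theorem bmw_pl_bdd (p q : ℝ) (hp : 0 < p) (hq : 0 < q) (hpq : p + q = 1) (f g h : ℝ → ENNReal)
    (hf : Measurable f) (hg : Measurable g) (hh : Measurable h) (c : ENNReal) (hc : c ≠ ⊤)
    (hf1 : ∀ x, f x ≤ c) (hg1 : ∀ x, g x ≤ c)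
    (H : ∀ x y, f x ^ p * g y ^ q ≤ h (p * x + q * y)) :
    (∫⁻ x, f x) ^ p * (∫⁻ x, g x) ^ q ≤ ∫⁻ x, h x := by
  set a := ⨆ x, f x with ha
  set b := ⨆ x, g x with hb
  have ha1 : a ≠ ⊤ := ((iSup_le hf1).trans_lt hc.lt_top).ne
  have hb1 : b ≠ ⊤ := ((iSup_le hg1).trans_lt hc.lt_top).ne
  by_cases ha0 : a = 0
  · have : ∀ x, f x = 0 := fun x => le_antisymm (ha0 ▸ le_iSup f x) zero_le
    simp [this, hp]
  by_cases hb0 : b = 0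
  · have : ∀ x, g x = 0 := fun x => le_antisymm (hb0 ▸ le_iSup g x) zero_le
    simp [this, hq]
  have hap0 : a ^ p ≠ 0 := by simp [ENNReal.rpow_eq_zero_iff, ha0, ha1]
  have hbq0 : b ^ q ≠ 0 := by simp [ENNReal.rpow_eq_zero_iff, hb0, hb1]
  have hap1 : a ^ p ≠ ⊤ := ENNReal.rpow_ne_top_of_nonneg hp.le ha1
  have hbq1 : b ^ q ≠ ⊤ := ENNReal.rpow_ne_top_of_nonneg hq.le hb1
  have key := bmw_pl_norm p q hp hq hpq (fun x => f x / a) (fun x => g x / b)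
    (fun x => h x / (a ^ p * b ^ q)) (hf.div_const _) (hg.div_const _) (hh.div_const _)
    (fun x => ENNReal.div_le_of_le_mul (by simpa using le_iSup f x))
    (fun x => ENNReal.div_le_of_le_mul (by simpa using le_iSup g x))
    (by
      intro t ht
      have : t * a < a := by
        calc t * a < 1 * a := ENNReal.mul_lt_mul_left ha0 ha1 ht
          _ = a := one_mul a
      obtain ⟨x, hx⟩ := lt_iSup_iff.1 this
      exact ⟨x, (ENNReal.lt_div_iff_mul_lt (Or.inl ha0) (Or.inl ha1)).2 hx⟩)
    (by
      intro t ht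
      have : t * b < b := by
        calc t * b < 1 * b := ENNReal.mul_lt_mul_left hb0 hb1 ht
          _ = b := one_mul b
      obtain ⟨x, hx⟩ := lt_iSup_iff.1 this
      exact ⟨x, (ENNReal.lt_div_iff_mul_lt (Or.inl hb0) (Or.inl hb1)).2 hx⟩)
    (by
      intro x y
      rw [ENNReal.div_rpow_of_nonneg _ _ hp.le, ENNReal.div_rpow_of_nonneg _ _ hq.le,
        ← ENNReal.mul_div_mul_comm (Or.inl hap0) (Or.inl hap1)]
      exact ENNReal.div_le_div_right (H x y) _)
  have key2 := (bmw_geom_arith p q hp hq hpq _ _).trans key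
  simp only [div_eq_mul_inv] at key2
  rw [lintegral_mul_const _ hf, lintegral_mul_const _ hg, lintegral_mul_const _ hh] at key2
  simp only [← div_eq_mul_inv] at key2
  rw [ENNReal.div_rpow_of_nonneg _ _ hp.le, ENNReal.div_rpow_of_nonneg _ _ hq.le,
        ← ENNReal.mul_div_mul_comm (Or.inl hap0) (Or.inl hap1)] at key2
  have h0 : a ^ p * b ^ q ≠ 0 := mul_ne_zero hap0 hbq0
  have h1 : a ^ p * b ^ q ≠ ⊤ := ENNReal.mul_ne_top hap1 hbq1
  rwa [ENNReal.div_le_iff h0 h1, ENNReal.div_mul_cancel h0 h1] at key2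

/-- Prékopa–Leindler as a property of a measure space with vector structure. -/
def BmwPL (E : Type) [MeasureSpace E] [AddCommGroup E] [Module ℝ E] : Prop :=
  ∀ p q : ℝ, 0 < p → 0 < q → p + q = 1 → ∀ f g h : E → ENNReal,
    Measurable f → Measurable g → Measurable h →
    (∀ x y, f x ^ p * g y ^ q ≤ h (p • x + q • y)) →
    (∫⁻ x, f x) ^ p * (∫⁻ x, g x) ^ q ≤ ∫⁻ x, h x

theorem bmw_lintegral_trunc (f : ℝ → ENNReal) (hf : Measurable f) :
    Filter.Tendsto (fun k : ℕ => ∫⁻ x, min (f x) k) Filter.atTop (nhds (∫⁻ x, f x)) := by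
  apply lintegral_tendsto_of_tendsto_of_monotone
  · intro k; exact (hf.min measurable_const).aemeasurable
  · filter_upwards with x
    intro i j hij
    simp only
    gcongr
  · filter_upwards with x
    have := (tendsto_const_nhds (x := f x)).min ENNReal.tendsto_nat_nhds_top
    simpa using this

theorem bmw_pl_real : BmwPL ℝ := by
  intro p q hp hq hpq f g h hf hg hh H
  by_cases hf0 : ∫⁻ x, f x = 0
  · simp [hf0, hp]
  by_cases hg0 : ∫⁻ x, g x = 0
  · simp [hg0, hq]
  have h1 := ((ENNReal.continuous_rpow_const (y := p)).tendsto _).comp (bmw_lintegral_trunc f hf)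
  have h2 := ((ENNReal.continuous_rpow_const (y := q)).tendsto _).comp (bmw_lintegral_trunc g hg)
  have h3 := ENNReal.Tendsto.mul h1 (Or.inl (by
    simp [ENNReal.rpow_eq_zero_iff, hf0, hp.not_gt])) h2 (Or.inl (by
    simp [ENNReal.rpow_eq_zero_iff, hg0, hq.not_gt]))
  refine le_of_tendsto' h3 ?_
  intro k
  apply bmw_pl_bdd p q hp hq hpq _ _ h (hf.min measurable_const) (hg.min measurable_const) hh k
    (by simp) (fun x => min_le_right _ _) (fun x => min_le_right _ _)
  intro x y
  refine le_trans ?_ (H x y)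
  gcongr <;> exact min_le_left _ _

theorem bmw_pl_prod (E F : Type) [MeasureSpace E] [AddCommGroup E] [Module ℝ E]
    [MeasureSpace F] [AddCommGroup F] [Module ℝ F]
    [SFinite (volume : Measure E)] [SFinite (volume : Measure F)]
    (hE : BmwPL E) (hF : BmwPL F) : BmwPL (E × F) := by
  intro p q hp hq hpq f g h hf hg hh H
  simp only [Measure.volume_eq_prod]
  rw [lintegral_prod _ hf.aemeasurable, lintegral_prod _ hg.aemeasurable,
    lintegral_prod _ hh.aemeasurable]
  apply hE p q hp hq hpq _ _ _ hf.lintegral_prod_right' hg.lintegral_prod_right'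
    hh.lintegral_prod_right'
  intro x x'
  apply hF p q hp hq hpq _ _ _ (hf.comp measurable_prodMk_left) (hg.comp measurable_prodMk_left)
    (hh.comp measurable_prodMk_left)
  intro y y'
  exact H (x, y) (x', y')

theorem bmw_pl_transfer (E F : Type) [MeasureSpace E] [AddCommGroup E] [Module ℝ E]
    [MeasureSpace F] [AddCommGroup F] [Module ℝ F] (e : E → F)
    (he : MeasurePreserving e volume volume)
    (hlin : ∀ (p q : ℝ) x y, e (p • x + q • y) = p • e x + q • e y)
    (hE : BmwPL E) : BmwPL F := by
  intro p q hp hq hpq f g h hf hg hh H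
  rw [← he.lintegral_comp hf, ← he.lintegral_comp hg, ← he.lintegral_comp hh]
  apply hE p q hp hq hpq _ _ _ (hf.comp he.measurable) (hg.comp he.measurable)
    (hh.comp he.measurable)
  intro x y
  simp only [Function.comp, hlin]
  exact H _ _

theorem bmw_pl_pi (m : ℕ) : BmwPL (Fin m → ℝ) := by
  induction m with
  | zero =>
    intro p q hp hq hpq f g h hf hg hh H
    simp only [volume_pi, Measure.pi_of_empty (fun _ : Fin 0 => (volume : Measure ℝ))]
    rw [lintegral_dirac' _ hf, lintegral_dirac' _ hg, lintegral_dirac' _ hh]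
    convert H _ _
  | succ m ih =>
    apply bmw_pl_transfer _ _ _ (volume_preserving_piFinSuccAbove (fun _ : Fin (m+1) => ℝ) 0).symm
      _ (bmw_pl_prod _ _ bmw_pl_real ih)
    intro p q x y
    apply (MeasurableEquiv.piFinSuccAbove (fun _ : Fin (m+1) => ℝ) 0).injective
    simp only [MeasurableEquiv.apply_symm_apply]
    ext i
    · simp [MeasurableEquiv.piFinSuccAbove]
    · simp [MeasurableEquiv.piFinSuccAbove, Fin.tail, Fin.consEquiv]

theorem bmw_pl_euc (m : ℕ) : BmwPL (EuclideanSpace ℝ (Fin m)) := by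
  apply bmw_pl_transfer _ _ _ (PiLp.volume_preserving_toLp (Fin m)) _ (bmw_pl_pi m)
  intro p q x y
  rfl

theorem bmw_mul {m : ℕ} (p q : ℝ) (hp : 0 < p) (hq : 0 < q) (hpq : p + q = 1)
    (A B C : Set (EuclideanSpace ℝ (Fin m)))
    (hA : MeasurableSet A) (hB : MeasurableSet B) (hC : MeasurableSet C)
    (h : ∀ x ∈ A, ∀ y ∈ B, p • x + q • y ∈ C) :
    volume A ^ p * volume B ^ q ≤ volume C := by
  have := bmw_pl_euc m p q hp hq hpq (A.indicator 1) (B.indicator 1) (C.indicator 1)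
    (measurable_one.indicator hA) (measurable_one.indicator hB) (measurable_one.indicator hC) ?_
  · simpa [lintegral_indicator_one, hA, hB, hC] using this
  · intro x y
    by_cases hx : x ∈ A
    · by_cases hy : y ∈ B
      · simp [hx, hy, h x hx y hy]
      · simp [hy, hq]
    · simp [hx, hp]

/-- Brunn–Minkowski in dimension-homogeneous form. -/
theorem bmw_BM {m : ℕ} (hm : 0 < m) (p q : ℝ) (hp : 0 < p) (hq : 0 < q)
    (A B C : Set (EuclideanSpace ℝ (Fin m)))
    (hA : MeasurableSet A) (hB : MeasurableSet B) (hC : MeasurableSet C)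
    (hAn : A.Nonempty) (hBn : B.Nonempty) 
    (hAf : volume A ≠ ⊤) (hBf : volume B ≠ ⊤) (hCf : volume C ≠ ⊤)
    (h : ∀ x ∈ A, ∀ y ∈ B, p • x + q • y ∈ C) :
    p * (volume A).toReal ^ ((1:ℝ)/m) + q * (volume B).toReal ^ ((1:ℝ)/m)
      ≤ (volume C).toReal ^ ((1:ℝ)/m) := by
  have hm' : (m:ℝ) ≠ 0 := by positivity
  have one_side : ∀ (r : ℝ), 0 < r → ∀ (c : EuclideanSpace ℝ (Fin m)) (D : Set (EuclideanSpace ℝ (Fin m))),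
      (∀ x ∈ D, r • x + c ∈ C) → r * (volume D).toReal ^ ((1:ℝ)/m) ≤ (volume C).toReal ^ ((1:ℝ)/m) := by
    intro r hr c D hD
    have e1 : volume ((fun x => x + c) '' (r • D)) ≤ volume C := by
      apply measure_mono
      rintro _ ⟨_, ⟨x, hx, rfl⟩, rfl⟩
      exact hD x hx
    rw [Set.image_add_right, measure_preimage_add_right, Measure.addHaar_smul] at e1
    have e2 := ENNReal.toReal_mono hCf e1
    rw [ENNReal.toReal_mul, ENNReal.toReal_ofReal (abs_nonneg _), abs_of_pos (by positivity)] at e2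
    simp only [finrank_euclideanSpace, Fintype.card_fin] at e2
    have e3 := Real.rpow_le_rpow (by positivity) e2 (z := (1:ℝ)/m) (by positivity)
    rw [Real.mul_rpow (by positivity) (by positivity), one_div, Real.pow_rpow_inv_natCast hr.le hm.ne'] at e3
    rwa [one_div]
  set a := (volume A).toReal ^ ((1:ℝ)/m) with ha
  set b := (volume B).toReal ^ ((1:ℝ)/m) with hb
  have ha0 : 0 ≤ a := by positivity
  have hb0 : 0 ≤ b := by positivity
  rcases ha0.eq_or_lt with ha0 | ha0
  · obtain ⟨x, hx⟩ := hAn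
    rw [← ha0]
    rw [mul_zero, zero_add]
    exact one_side q hq (p • x) B (fun y hy => by rw [add_comm]; exact h x hx y hy)
  rcases hb0.eq_or_lt with hb0 | hb0
  · obtain ⟨y, hy⟩ := hBn
    rw [← hb0]
    rw [mul_zero, add_zero]
    exact one_side p hp (q • y) A (fun x hx => h x hx y hy)
  have ham : a ^ m = (volume A).toReal := by
    rw [ha, one_div, Real.rpow_inv_natCast_pow (by positivity) hm.ne']
  have hbm : b ^ m = (volume B).toReal := by
    rw [hb, one_div, Real.rpow_inv_natCast_pow (by positivity) hm.ne']
  set D := p * a + q * b with hD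
  have hD0 : 0 < D := by positivity
  have scale : ∀ (r : ℝ), 0 < r → ∀ S : Set (EuclideanSpace ℝ (Fin m)), volume (r⁻¹ • S) =
      ENNReal.ofReal ((r ^ m)⁻¹) * volume S := by
    intro r hr S
    rw [Measure.addHaar_smul]
    simp only [finrank_euclideanSpace, Fintype.card_fin]
    rw [abs_of_pos (by positivity), inv_pow]
  have unit : ∀ (r : ℝ), 0 < r → ∀ S : Set (EuclideanSpace ℝ (Fin m)), volume S ≠ ⊤ → r ^ m = (volume S).toReal →
      volume (r⁻¹ • S) = 1 := by
    intro r hr S hS h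
    rw [scale r hr, ← ENNReal.ofReal_toReal hS, ← h, ← ENNReal.ofReal_mul (by positivity),
      inv_mul_cancel₀ (by positivity), ENNReal.ofReal_one]
  have key := bmw_mul (p * a / D) (q * b / D) (by positivity) (by positivity)
    (by rw [← add_div, div_self hD0.ne']) (a⁻¹ • A) (b⁻¹ • B) (D⁻¹ • C)
    (hA.const_smul₀ _) (hB.const_smul₀ _) (hC.const_smul₀ _) (by
      rintro _ ⟨x, hx, rfl⟩ _ ⟨y, hy, rfl⟩
      refine ⟨p • x + q • y, h x hx y hy, ?_⟩
      simp only [smul_add, smul_smul]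
      congr 2 <;> field_simp)
  rw [unit a ha0 A hAf ham, unit b hb0 B hBf hbm, scale D hD0] at key
  simp only [ENNReal.one_rpow, one_mul] at key
  rw [← ENNReal.ofReal_toReal hCf, ← ENNReal.ofReal_mul (by positivity), ENNReal.one_le_ofReal,
    inv_mul_eq_div, one_le_div (by positivity)] at key
  have e3 := Real.rpow_le_rpow (by positivity) key (z := (1:ℝ)/m) (by positivity)
  rw [one_div, Real.pow_rpow_inv_natCast hD0.le hm.ne'] at e3
  rwa [one_div]

/-- support line for a concave antitone function on (0,1) -/
theorem bmw_support (v : ℝ → ℝ) (hv : ∀ s ∈ Ioo (0:ℝ) 1, 0 ≤ v s)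
    (hmono : ∀ s ∈ Ioo (0:ℝ) 1, ∀ t ∈ Ioo (0:ℝ) 1, s ≤ t → v t ≤ v s)
    (hconc : ConcaveOn ℝ (Ioo (0:ℝ) 1) v) (s₀ : ℝ) (hs : s₀ ∈ Ioo (0:ℝ) 1) :
    ∃ α ∈ Icc (0:ℝ) 1, ∀ s ∈ Ioo (0:ℝ) 1,
      v s ≤ (1 - α) * v s₀ + α * (v s₀ / (1 - s₀) * (1 - s)) := by
  have hs1 : 0 < 1 - s₀ := by linarith [hs.2]
  set t := v s₀ with ht
  have ht0 : 0 ≤ t := hv s₀ hs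
  set S := (fun s => (v s - t) / (s₀ - s)) '' Ioo 0 s₀ with hS
  have hSn : S.Nonempty := ⟨_, s₀ / 2, ⟨by linarith [hs.1], by linarith [hs.1]⟩, rfl⟩
  have slope : ∀ s ∈ Ioo 0 s₀, ∀ u ∈ Ioo s₀ 1, (v s - t) / (s₀ - s) ≤ (t - v u) / (u - s₀) := by
    intro s hs' u hu
    have := hconc.slope_anti_adjacent (x := s) (y := s₀) (z := u) ⟨hs'.1, hs'.2.trans hs.2⟩
      ⟨hs.1.trans hu.1, hu.2⟩ hs'.2 hu.1
    rw [← neg_sub t (v s), neg_div, ← neg_sub (v u) t, neg_div]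
    linarith
  have bdd1 : ∀ x ∈ S, ∀ u ∈ Ioo s₀ 1, x ≤ (t - v u) / (u - s₀) := by
    rintro _ ⟨s, hs', rfl⟩ u hu
    exact slope s hs' u hu
  have hmid : (s₀ + 1) / 2 ∈ Ioo s₀ 1 := ⟨by linarith, by linarith [hs.2]⟩
  have hbdd : BddAbove S := ⟨_, fun x hx => bdd1 x hx _ hmid⟩
  set μ := sSup S with hμ
  have hμ1 : ∀ u ∈ Ioo s₀ 1, μ ≤ (t - v u) / (u - s₀) := fun u hu =>
    csSup_le hSn (fun x hx => bdd1 x hx u hu)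
  have hμ2 : ∀ s ∈ Ioo 0 s₀, (v s - t) / (s₀ - s) ≤ μ := fun s hs' =>
    le_csSup hbdd ⟨s, hs', rfl⟩
  have hμ0 : 0 ≤ μ := by
    refine le_trans ?_ (hμ2 (s₀ / 2) ⟨by linarith [hs.1], by linarith [hs.1]⟩)
    apply div_nonneg
    · have := hmono (s₀/2) ⟨by linarith [hs.1], by linarith [hs.1, hs.2]⟩ s₀ hs (by linarith [hs.1])
      linarith
    · linarith [hs.1]
  have hμt : μ * (1 - s₀) ≤ t := by
    by_contra hcon
    push Not at hcon
    have hμp : 0 < μ := by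
      rcases hμ0.eq_or_lt with h | h
      · rw [← h] at hcon; linarith
      · exact h
    have h1 : t / μ < 1 - s₀ := by rwa [div_lt_iff₀ hμp, mul_comm]
    have h2 : 0 ≤ t / μ := by positivity
    have hu : (s₀ + t / μ + 1) / 2 ∈ Ioo s₀ 1 := ⟨by linarith, by linarith⟩
    have h3 := hμ1 _ hu
    have h4 := hv _ ⟨hs.1.trans hu.1, hu.2⟩
    rw [le_div_iff₀ (by linarith [hu.1])] at h3
    have h5 : t < μ * ((s₀ + t / μ + 1) / 2 - s₀) := by
      rw [← div_lt_iff₀' hμp]; linarith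
    linarith
  have main : ∀ s ∈ Ioo (0:ℝ) 1, v s ≤ t - μ * (s - s₀) := by
    intro s hs'
    rcases lt_trichotomy s s₀ with h | h | h
    · have := hμ2 s ⟨hs'.1, h⟩
      rw [div_le_iff₀ (by linarith)] at this
      linarith
    · subst h; simp [ht]
    · have := hμ1 s ⟨h, hs'.2⟩
      rw [le_div_iff₀ (by linarith)] at this
      linarith
  rcases ht0.eq_or_lt with h | h
  · refine ⟨0, by simp, fun s hs' => ?_⟩
    have hμz : μ = 0 := by
      have : μ * (1 - s₀) ≤ 0 := by rw [h]; exact hμt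
      nlinarith
    have := main s hs'
    rw [hμz] at this
    linarith
  · refine ⟨μ * (1 - s₀) / t, ⟨by positivity, (div_le_one h).2 hμt⟩, fun s hs' => ?_⟩
    refine (main s hs').trans (le_of_eq ?_)
    field_simp
    ring

theorem bmw_beta (m : ℕ) (hm : 0 < m) :
    ∫ s in (0:ℝ)..1, s ^ (m - 1) * (m * (1 - s) ^ m) = 1 / (Nat.choose (2 * m) m : ℝ) := by
  have h := Complex.betaIntegral_eq_Gamma_mul_div (m : ℂ) ((m + 1 : ℕ) : ℂ) (by simpa using hm)
    (by simp; positivity)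
  obtain ⟨k, rfl⟩ : ∃ k, m = k + 1 := ⟨m - 1, by omega⟩
  have e1 : Complex.betaIntegral ((k + 1 : ℕ) : ℂ) ((k + 1 + 1 : ℕ) : ℂ) =
      ((∫ s in (0:ℝ)..1, s ^ k * (1 - s) ^ (k + 1) : ℝ) : ℂ) := by
    rw [Complex.betaIntegral, ← intervalIntegral.integral_ofReal]
    congr 1
    ext x
    have a1 : ((k + 1 : ℕ) : ℂ) - 1 = (k : ℕ) := by push_cast; ring
    have a2 : ((k + 1 + 1 : ℕ) : ℂ) - 1 = ((k + 1 : ℕ) : ℂ) := by push_cast; ring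
    rw [a1, a2, Complex.cpow_natCast, Complex.cpow_natCast]
    push_cast; rfl
  have e2 : ((k + 1 : ℕ) : ℂ) + ((k + 1 + 1 : ℕ) : ℂ) = ((2 * (k + 1) : ℕ) : ℂ) + 1 := by
    push_cast; ring
  have e3 := Complex.Gamma_nat_eq_factorial k
  have e4 := Complex.Gamma_nat_eq_factorial (k + 1)
  have e5 := Complex.Gamma_nat_eq_factorial (2 * (k + 1))
  rw [e1, e2, e5] at h
  have e3' : Complex.Gamma ((k + 1 : ℕ) : ℂ) = (k.factorial : ℂ) := by
    rw [← e3]; push_cast; rfl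
  have e4' : Complex.Gamma ((k + 1 + 1 : ℕ) : ℂ) = ((k + 1).factorial : ℂ) := by
    rw [← e4]; push_cast; rfl
  rw [e3', e4'] at h
  have h' : ∫ s in (0:ℝ)..1, s ^ k * (1 - s) ^ (k + 1) =
      (k.factorial : ℝ) * (k + 1).factorial / (2 * (k + 1)).factorial := by
    apply Complex.ofReal_injective
    rw [h]
    push_cast
    rfl
  have e6 : ∫ s in (0:ℝ)..1, s ^ (k + 1 - 1) * (((k + 1 : ℕ) : ℝ) * (1 - s) ^ (k + 1)) =
      ((k + 1 : ℕ) : ℝ) * ∫ s in (0:ℝ)..1, s ^ k * (1 - s) ^ (k + 1) := by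
    rw [← intervalIntegral.integral_const_mul]
    congr 1
    ext x
    simp only [Nat.add_sub_cancel]
    ring
  rw [e6, h']
  have c := Nat.add_choose_mul_factorial_mul_factorial (k + 1) (k + 1)
  rw [← two_mul] at c
  have c' : ((Nat.choose (2 * (k + 1)) (k + 1) : ℕ) : ℝ) * (k + 1).factorial * (k + 1).factorial
      = (2 * (k + 1)).factorial := by exact_mod_cast c
  have c0 : ((Nat.choose (2 * (k + 1)) (k + 1) : ℕ) : ℝ) ≠ 0 := by
    have := Nat.choose_pos (show k + 1 ≤ 2 * (k + 1) by omega)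
    positivity
  have c1 : ((k + 1).factorial : ℝ) = ((k + 1 : ℕ) : ℝ) * k.factorial := by
    exact_mod_cast Nat.factorial_succ k
  have c2 : ((k + 1).factorial : ℝ) ≠ 0 := by positivity
  rw [← c']
  field_simp
  rw [← c1]

theorem bmw_poly_int (m : ℕ) (hm : 0 < m) (a b : ℝ) :
    ∫ s in (0:ℝ)..1, (m:ℝ) * s ^ (m - 1) * (a + b * (1 - s) ^ m) =
      a + b / (Nat.choose (2 * m) m : ℝ) := by
  have e : ∀ s : ℝ, (m:ℝ) * s ^ (m - 1) * (a + b * (1 - s) ^ m) =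
      (a * m) * s ^ (m - 1) + b * (s ^ (m - 1) * (m * (1 - s) ^ m)) := by intro s; ring
  simp_rw [e]
  rw [intervalIntegral.integral_add, intervalIntegral.integral_const_mul,
    intervalIntegral.integral_const_mul, bmw_beta m hm, integral_pow]
  · have : ((m - 1 : ℕ) : ℝ) + 1 = m := by
      have : m - 1 + 1 = m := by omega
      exact_mod_cast this
    rw [this]
    have : m - 1 + 1 ≠ 0 := by omega
    have hm' : (m : ℝ) ≠ 0 := by positivity
    simp
    field_simp
  · exact (by fun_prop : Continuous _).intervalIntegrable _ _
  · exact (by fun_prop : Continuous _).intervalIntegrable _ _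

theorem bmw_core {m : ℕ} (hm : 0 < m) (f : EuclideanSpace ℝ (Fin m) → ℝ)
    (hf : Measurable f) (hf0 : ∀ z, 0 ≤ f z) (hf1 : ∀ z, f z ≤ 1)
    (hsup : ∀ s < 1, ∃ z, s ≤ f z) (hfin : volume {z | 0 < f z} ≠ ⊤)
    (hconc : ∀ p q : ℝ, 0 < p → 0 < q → p + q = 1 → ∀ x y, 0 < f x → 0 < f y →
      p * f x + q * f y ≤ f (p • x + q • y))
    (s₀ : ℝ) (hs : 3 / 4 ≤ s₀) (hs1 : s₀ < 1) :
    ∫⁻ z, ENNReal.ofReal (f z ^ m) ≤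
      ENNReal.ofReal ((volume {z | s₀ ≤ f z}).toReal / ((1 - s₀) ^ m * Nat.choose (2 * m) m)) := by
  have hm' : (0:ℝ) < m := by positivity
  have hCf : ∀ s, 0 < s → volume {z | s ≤ f z} ≠ ⊤ := fun s hs =>
    ne_top_of_le_ne_top hfin (measure_mono (fun z hz => lt_of_lt_of_le hs hz))
  set v : ℝ → ℝ := fun s => (volume {z | s ≤ f z}).toReal ^ ((1:ℝ)/m) with hv
  have hvm : ∀ s, v s ^ m = (volume {z | s ≤ f z}).toReal := by
    intro s
    simp only [hv]
    rw [one_div, Real.rpow_inv_natCast_pow (by positivity) hm.ne']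
  have hv0 : ∀ s, 0 ≤ v s := fun s => by simp only [hv]; positivity
  have hs0 : s₀ ∈ Ioo (0:ℝ) 1 := ⟨by linarith, hs1⟩
  obtain ⟨α, hα, hsupp⟩ := bmw_support v (fun s _ => hv0 s) (by
      intro s hs t ht hst
      simp only [hv]
      refine Real.rpow_le_rpow (by positivity) ?_ (by positivity)
      exact ENNReal.toReal_mono (hCf s hs.1) (measure_mono (fun z hz => le_trans hst hz)))
    (by
      rw [concaveOn_iff_forall_pos]
      refine ⟨convex_Ioo _ _, ?_⟩
      intro s hs t ht p q hp hq hpq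
      simp only [smul_eq_mul]
      have hst : p * s + q * t ∈ Ioo (0:ℝ) 1 := by
        constructor
        · have := mul_pos hp hs.1
          have := mul_pos hq ht.1
          linarith
        · have := mul_lt_mul_of_pos_left hs.2 hp
          have := mul_lt_mul_of_pos_left ht.2 hq
          linarith
      apply bmw_BM hm p q hp hq _ _ _ (measurableSet_le measurable_const hf)
        (measurableSet_le measurable_const hf) (measurableSet_le measurable_const hf)
        (hsup s hs.2) (hsup t ht.2) (hCf s hs.1) (hCf t ht.1) (hCf _ hst.1)
      intro x hx y hy
      have hx' : s ≤ f x := hx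
      have hy' : t ≤ f y := hy
      refine le_trans ?_ (hconc p q hp hq hpq x y (hs.1.trans_le hx) (ht.1.trans_le hy))
      gcongr) s₀ hs0
  set T := (volume {z | s₀ ≤ f z}).toReal with hT
  have hT0 : 0 ≤ T := by positivity
  have h1s : 0 < 1 - s₀ := by linarith
  set R := T / (1 - s₀) ^ m with hR
  have hR0 : 0 ≤ R := by positivity
  have hpt : ∀ s ∈ Ioo (0:ℝ) 1, volume {z | s ≤ f z} ≤
      ENNReal.ofReal ((1 - α) * T + α * R * (1 - s) ^ m) := by
    intro s hs
    rw [← ENNReal.ofReal_toReal (hCf s hs.1), ← hvm s]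
    apply ENNReal.ofReal_le_ofReal
    have h1 := pow_le_pow_left₀ (hv0 s) (hsupp s hs) m
    refine h1.trans ?_
    have h2 := (convexOn_pow m).2 (show v s₀ ∈ Ici (0:ℝ) from hv0 s₀)
      (show v s₀ / (1 - s₀) * (1 - s) ∈ Ici (0:ℝ) from
        mul_nonneg (div_nonneg (hv0 _) h1s.le) (by linarith [hs.2]))
      (show 0 ≤ 1 - α by linarith [hα.2]) hα.1 (by ring)
    simp only [smul_eq_mul] at h2
    refine h2.trans (le_of_eq ?_)
    rw [mul_pow, div_pow, hvm]
    ring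
  have hpow := lintegral_rpow_eq_lintegral_meas_le_mul volume (f := f)
    (by filter_upwards with z; exact hf0 z) hf.aemeasurable hm'
  simp only [Real.rpow_natCast] at hpow
  rw [hpow]
  have hsplit : Ioi (0:ℝ) = Ioc 0 1 ∪ Ioi 1 := by
    rw [Ioc_union_Ioi_eq_Ioi]; norm_num
  rw [hsplit, lintegral_union measurableSet_Ioi (by
    rw [Set.disjoint_left]; rintro x hx hx'; exact absurd hx.2 (not_le.2 hx'))]
  have hz : ∫⁻ t in Ioi (1:ℝ), volume {a | t ≤ f a} * ENNReal.ofReal (t ^ ((m:ℝ) - 1)) = 0 := by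
    rw [setLIntegral_congr_fun (g := fun _ => 0) measurableSet_Ioi]
    · simp
    · intro t ht
      have : {a | t ≤ f a} = ∅ := by
        ext x
        have := hf1 x
        simp only [mem_Ioi] at ht
        simp; linarith
      simp [this]
  rw [hz, add_zero]
  have hmc : (((m - 1 : ℕ) : ℝ)) = (m:ℝ) - 1 := by
    rw [Nat.cast_sub hm]; simp
  calc _ = ENNReal.ofReal m * ∫⁻ t in Ioo (0:ℝ) 1, volume {a | t ≤ f a} * ENNReal.ofReal (t ^ ((m:ℝ) - 1)) := by
        rw [setLIntegral_congr Ioo_ae_eq_Ioc]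
    _ ≤ ENNReal.ofReal m * ∫⁻ t in Ioo (0:ℝ) 1,
          ENNReal.ofReal (((1 - α) * T + α * R * (1 - t) ^ m) * t ^ (m - 1)) := by
        gcongr 1
        apply setLIntegral_mono' measurableSet_Ioo
        intro t ht
        rw [ENNReal.ofReal_mul' (by have := ht.1; positivity), ← hmc, Real.rpow_natCast]
        gcongr
        exact hpt t ht
    _ = ∫⁻ t in Ioo (0:ℝ) 1,
          ENNReal.ofReal ((m:ℝ) * t ^ (m - 1) * ((1 - α) * T + α * R * (1 - t) ^ m)) := by
        rw [← lintegral_const_mul _ (by fun_prop)]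
        apply setLIntegral_congr_fun measurableSet_Ioo
        intro t ht
        simp only
        rw [← ENNReal.ofReal_mul (by positivity)]
        congr 1; ring
    _ = ENNReal.ofReal (∫ t in (0:ℝ)..1, (m:ℝ) * t ^ (m - 1) * ((1 - α) * T + α * R * (1 - t) ^ m)) := by
        rw [setLIntegral_congr Ioo_ae_eq_Ioc, intervalIntegral.integral_of_le zero_le_one,
          ofReal_integral_eq_lintegral_ofReal]
        · exact ((by fun_prop : Continuous (fun t : ℝ => (m:ℝ) * t ^ (m - 1) *
            ((1 - α) * T + α * R * (1 - t) ^ m))).intervalIntegrable 0 1).1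
        · filter_upwards [ae_restrict_mem measurableSet_Ioc] with t ht
          have a1 := ht.1
          have a2 : 0 ≤ 1 - t := by linarith [ht.2]
          have a3 := hα.1
          have a4 : 0 ≤ 1 - α := by linarith [hα.2]
          simp only [Pi.zero_apply]
          positivity
    _ ≤ _ := by
        rw [bmw_poly_int m hm]
        apply ENNReal.ofReal_le_ofReal
        have hc0 : (0:ℝ) < Nat.choose (2 * m) m := by
          have := Nat.choose_pos (show m ≤ 2 * m by omega)
          positivity
        have hc4 : (Nat.choose (2 * m) m : ℝ) ≤ 4 ^ m := by
          have := Nat.choose_le_two_pow (2 * m) m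
          rw [pow_mul] at this
          norm_num at this
          exact_mod_cast this
        have hle : (1 - s₀) ^ m * (Nat.choose (2 * m) m : ℝ) ≤ 1 := by
          calc (1 - s₀) ^ m * (Nat.choose (2 * m) m : ℝ) ≤ (1/4) ^ m * 4 ^ m := by
                gcongr; linarith
            _ = 1 := by rw [← mul_pow]; norm_num
        have hRT : T ≤ R / (Nat.choose (2 * m) m : ℝ) := by
          rw [hR, div_div, le_div_iff₀ (by positivity)]
          exact mul_le_of_le_one_right hT0 hle
        rw [← div_div, ← hR]
        have : (1 - α) * T ≤ (1 - α) * (R / (Nat.choose (2 * m) m : ℝ)) :=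
          mul_le_mul_of_nonneg_left hRT (by linarith [hα.2])
        calc _ ≤ (1 - α) * (R / (Nat.choose (2 * m) m : ℝ)) + α * R / (Nat.choose (2 * m) m : ℝ) := by linarith
          _ = _ := by ring

theorem bmw_covar_meas (K L : Set (EuclideanSpace ℝ (Fin n))) (hK : MeasurableSet K)
    (hL : MeasurableSet L) :
    Measurable (fun z => volume {x | x ∈ K ∧ z - x ∈ L}) := by
  have : MeasurableSet {w : EuclideanSpace ℝ (Fin n) × EuclideanSpace ℝ (Fin n) |
      w.2 ∈ K ∧ w.1 - w.2 ∈ L} :=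
    (measurable_snd hK).inter ((measurable_fst.sub measurable_snd) hL)
  exact measurable_measure_prodMk_left (ν := (volume : Measure (EuclideanSpace ℝ (Fin n)))) this

theorem bmw_covar_int (K L : Set (EuclideanSpace ℝ (Fin n))) (hK : MeasurableSet K)
    (hL : MeasurableSet L) :
    ∫⁻ z, volume {x | x ∈ K ∧ z - x ∈ L} = volume K * volume L := by
  have hm : MeasurableSet {w : EuclideanSpace ℝ (Fin n) × EuclideanSpace ℝ (Fin n) |
      w.2 ∈ K ∧ w.1 - w.2 ∈ L} :=
    (measurable_snd hK).inter ((measurable_fst.sub measurable_snd) hL)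
  have h1 := Measure.prod_apply (μ := (volume : Measure (EuclideanSpace ℝ (Fin n))))
    (ν := (volume : Measure (EuclideanSpace ℝ (Fin n)))) hm
  have h2 := Measure.prod_apply_symm (μ := (volume : Measure (EuclideanSpace ℝ (Fin n))))
    (ν := (volume : Measure (EuclideanSpace ℝ (Fin n)))) hm
  refine Eq.trans (h1.symm.trans h2) ?_
  have h3 : ∀ y : EuclideanSpace ℝ (Fin n), volume ((fun x => (x, y)) ⁻¹'
      {w : EuclideanSpace ℝ (Fin n) × EuclideanSpace ℝ (Fin n) | w.2 ∈ K ∧ w.1 - w.2 ∈ L}) =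
      K.indicator (fun _ => volume L) y := by
    intro y
    by_cases hy : y ∈ K
    · have : (fun x => (x, y)) ⁻¹' {w : EuclideanSpace ℝ (Fin n) × EuclideanSpace ℝ (Fin n) |
          w.2 ∈ K ∧ w.1 - w.2 ∈ L} = (fun x => x - y) ⁻¹' L := by
        ext x; simp [hy]
      rw [this]
      simp [hy, sub_eq_add_neg, measure_preimage_add_right]
    · simp [hy]
  simp_rw [h3]
  rw [lintegral_indicator hK, setLIntegral_const, mul_comm]

theorem thetaConv_brunn_minkowski_improved_large (hn : 0 < n)
    (K L : Set (EuclideanSpace ℝ (Fin n)))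
    (hK : IsConvexBody K) (hL : IsConvexBody L) (θ : ℝ)
    (hθ : ((3:ℝ)/4) ^ n ≤ θ) (hθ1 : θ ≤ 1) :
    (volume (thetaConv K L θ)).toReal ^ ((1:ℝ)/n) ≥
      (1/2) * ((Nat.choose (2*n) n : ℝ)) ^ ((1:ℝ)/n) * (1 - θ ^ ((1:ℝ)/n)) *
        ((volume K).toReal ^ ((1:ℝ)/n) + (volume L).toReal ^ ((1:ℝ)/n)) := by
  obtain ⟨hKc, hKv, hKi⟩ := hK
  obtain ⟨hLc, hLv, hLi⟩ := hL
  have hn' : (0:ℝ) < n := by positivity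
  have hn1 : (n:ℝ) ≠ 0 := hn'.ne'
  have hθ0 : 0 < θ := lt_of_lt_of_le (by positivity) hθ
  set s₀ := θ ^ ((1:ℝ)/n) with hs₀
  have hs0n : s₀ ^ n = θ := by
    rw [hs₀, one_div, Real.rpow_inv_natCast_pow hθ0.le hn.ne']
  have hs00 : 0 < s₀ := by positivity
  have hs34 : 3 / 4 ≤ s₀ := by
    have := Real.rpow_le_rpow (by positivity) hθ (z := (1:ℝ)/n) (by positivity)
    rwa [one_div, Real.pow_rpow_inv_natCast (by norm_num) hn.ne', ← one_div] at this
  have hs01 : s₀ ≤ 1 := Real.rpow_le_one hθ0.le hθ1 (by positivity)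
  rcases hs01.eq_or_lt with h1 | hs1
  · rw [h1]
    simp only [sub_self, mul_zero, zero_mul, ge_iff_le]
    positivity
  have hKf : volume K ≠ ⊤ := hKc.measure_lt_top.ne
  have hLf : volume L ≠ ⊤ := hLc.measure_lt_top.ne
  have hKp : 0 < (volume K).toReal := ENNReal.toReal_pos (Measure.measure_pos_of_nonempty_interior _ hKi).ne' hKf
  have hLp : 0 < (volume L).toReal := ENNReal.toReal_pos (Measure.measure_pos_of_nonempty_interior _ hLi).ne' hLf
  have hsubK : ∀ z, {x | x ∈ K ∧ z - x ∈ L} ⊆ K := fun z x hx => hx.1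
  have hAf : ∀ z, volume {x | x ∈ K ∧ z - x ∈ L} ≠ ⊤ := fun z =>
    ne_top_of_le_ne_top hKf (measure_mono (hsubK z))
  have hcK : ∀ z, covar K L z ≤ (volume K).toReal := fun z =>
    ENNReal.toReal_mono hKf (measure_mono (hsubK z))
  have hcL : ∀ z, covar K L z ≤ (volume L).toReal := by
    intro z
    apply ENNReal.toReal_mono hLf
    have : volume ((fun x => z - x) ⁻¹' L) = volume L :=
      (Measure.measurePreserving_sub_left volume z).measure_preimage hLc.measurableSet.nullMeasurableSet
    rw [← this]
    exact measure_mono (fun x hx => hx.2)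
  have hc0 : ∀ z, 0 ≤ covar K L z := fun z => ENNReal.toReal_nonneg
  have hbdd : BddAbove (Set.range (covar K L)) := ⟨_, by rintro _ ⟨z, rfl⟩; exact hcK z⟩
  have hcM : ∀ z, covar K L z ≤ Mmax K L := fun z => le_ciSup hbdd z
  have hMK : Mmax K L ≤ (volume K).toReal := ciSup_le hcK
  have hML : Mmax K L ≤ (volume L).toReal := ciSup_le hcL
  have hint : ∫⁻ z, ENNReal.ofReal (covar K L z) = volume K * volume L := by
    rw [← bmw_covar_int K L hKc.measurableSet hLc.measurableSet]
    exact lintegral_congr (fun z => ENNReal.ofReal_toReal (hAf z))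
  have hM0 : 0 < Mmax K L := by
    by_contra hcon
    push Not at hcon
    have : ∀ z, ENNReal.ofReal (covar K L z) = 0 := fun z =>
      ENNReal.ofReal_eq_zero.2 ((hcM z).trans hcon)
    simp only [this, lintegral_zero] at hint
    have h2 := congrArg ENNReal.toReal hint
    rw [ENNReal.toReal_mul] at h2
    have := mul_pos hKp hLp
    rw [ENNReal.toReal_zero] at h2
    linarith
  set M := Mmax K L with hM
  -- the normalised function
  set f : EuclideanSpace ℝ (Fin n) → ℝ := fun z => (covar K L z / M) ^ ((1:ℝ)/n) with hfdef
  have hfn : ∀ z, f z ^ n = covar K L z / M := by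
    intro z
    simp only [hfdef]
    rw [one_div, Real.rpow_inv_natCast_pow (div_nonneg (hc0 z) hM0.le) hn.ne']
  have hf0 : ∀ z, 0 ≤ f z := fun z => Real.rpow_nonneg (div_nonneg (hc0 z) hM0.le) _
  have hfpos : ∀ z, 0 < f z → 0 < covar K L z := by
    intro z hz
    have : 0 < covar K L z / M := by rw [← hfn]; positivity
    exact (div_pos_iff_of_pos_right hM0).1 this
  have hnonempty : ∀ z, 0 < covar K L z → {x | x ∈ K ∧ z - x ∈ L}.Nonempty := by
    intro z hz
    rw [Set.nonempty_iff_ne_empty]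
    intro h
    simp only [covar, h, measure_empty, ENNReal.toReal_zero, lt_irrefl] at hz
  have hKL : ∀ z, 0 < f z → z ∈ K + L := by
    intro z hz
    obtain ⟨x, hx, hx'⟩ := hnonempty z (hfpos z hz)
    exact ⟨x, hx, z - x, hx', by simp⟩
  have hKLf : volume (K + L) ≠ ⊤ := (hKc.add hLc).measure_lt_top.ne
  have hAm : ∀ z, MeasurableSet {x | x ∈ K ∧ z - x ∈ L} := fun z =>
    hKc.measurableSet.inter ((measurable_const.sub measurable_id) hLc.measurableSet)
  have core := bmw_core hn f
    (((bmw_covar_meas K L hKc.measurableSet hLc.measurableSet).ennreal_toReal.div_const M).pow_const _)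
    hf0
    (by
      intro z
      apply Real.rpow_le_one (div_nonneg (hc0 z) hM0.le) _ (by positivity)
      exact (div_le_one hM0).2 (hcM z))
    (by
      intro s hs
      rcases lt_or_ge s 0 with h | h
      · exact ⟨0, h.le.trans (hf0 _)⟩
      have hsM : s ^ n * M < M := by
        have : s ^ n < 1 := pow_lt_one₀ h hs hn.ne'
        nlinarith
      obtain ⟨z, hz⟩ := exists_lt_of_lt_ciSup hsM
      refine ⟨z, ?_⟩
      apply le_of_pow_le_pow_left₀ hn.ne' (hf0 z)
      rw [hfn, le_div_iff₀ hM0]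
      exact hz.le)
    (ne_top_of_le_ne_top hKLf (measure_mono hKL))
    (by
      intro p q hp hq hpq x y hx hy
      have bm := bmw_BM hn p q hp hq {w | w ∈ K ∧ x - w ∈ L} {w | w ∈ K ∧ y - w ∈ L}
        {w | w ∈ K ∧ (p • x + q • y) - w ∈ L} (hAm _) (hAm _) (hAm _)
        (hnonempty x (hfpos x hx)) (hnonempty y (hfpos y hy)) (hAf _) (hAf _) (hAf _)
        (by
          intro a ha b hb
          refine ⟨hKv ha.1 hb.1 hp.le hq.le hpq, ?_⟩
          have := hLv ha.2 hb.2 hp.le hq.le hpq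
          convert this using 1
          simp only [smul_sub]
          abel)
      simp only [hfdef]
      rw [Real.div_rpow (hc0 _) hM0.le, Real.div_rpow (hc0 _) hM0.le, Real.div_rpow (hc0 _) hM0.le,
        ← mul_div_assoc, ← mul_div_assoc, ← add_div]
      exact div_le_div_of_nonneg_right bm (by positivity))
    s₀ hs34 hs1
  set T := (volume (thetaConv K L θ)).toReal with hT
  have hsub : {z | s₀ ≤ f z} ⊆ thetaConv K L θ := by
    intro z hz
    have hz' : s₀ ≤ f z := hz
    refine ⟨hKL z (hs00.trans_le hz'), ?_⟩
    have := pow_le_pow_left₀ hs00.le hz' n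
    rwa [hs0n, hfn, le_div_iff₀ hM0] at this
  have hTf : volume (thetaConv K L θ) ≠ ⊤ :=
    ne_top_of_le_ne_top hKLf (measure_mono (fun z hz => hz.1))
  have hTle : (volume {z | s₀ ≤ f z}).toReal ≤ T := ENNReal.toReal_mono hTf (measure_mono hsub)
  have hb0 : (0:ℝ) < Nat.choose (2 * n) n := by
    have := Nat.choose_pos (show n ≤ 2 * n by omega)
    positivity
  have h1s : 0 < 1 - s₀ := by linarith
  set c := (Nat.choose (2 * n) n : ℝ) with hc
  have hT0 : 0 ≤ T := ENNReal.toReal_nonneg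
  have hV : (volume K).toReal * (volume L).toReal / M ≤ T / ((1 - s₀) ^ n * c) := by
    have e1 : ∫⁻ z, ENNReal.ofReal (f z ^ n) =
        ENNReal.ofReal ((volume K).toReal * (volume L).toReal / M) := by
      simp_rw [hfn, div_eq_mul_inv]
      simp_rw [ENNReal.ofReal_mul' (inv_nonneg.2 hM0.le)]
      rw [lintegral_mul_const', hint, ENNReal.ofReal_mul hKp.le, ENNReal.ofReal_toReal hKf,
        ENNReal.ofReal_toReal hLf]
      exact ENNReal.ofReal_ne_top
    rw [e1] at core
    have core2 := (ENNReal.ofReal_le_ofReal_iff (by positivity)).1 core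
    exact core2.trans (by gcongr)
  have fin : ∀ k : ℝ, 0 ≤ k → k ≤ (volume K).toReal * (volume L).toReal / M →
      c ^ ((1:ℝ)/n) * (1 - s₀) * k ^ ((1:ℝ)/n) ≤ T ^ ((1:ℝ)/n) := by
    intro k hk0 hk
    have h3 := hk.trans hV
    rw [le_div_iff₀ (by positivity)] at h3
    have h4 := Real.rpow_le_rpow (by positivity) h3 (z := (1:ℝ)/n) (by positivity)
    rw [Real.mul_rpow hk0 (by positivity), Real.mul_rpow (by positivity) hb0.le] at h4
    have h5 : ((1 - s₀) ^ n) ^ ((1:ℝ)/n) = 1 - s₀ := by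
      rw [one_div, Real.pow_rpow_inv_natCast h1s.le hn.ne']
    rw [h5] at h4
    linarith
  have fK := fin (volume K).toReal hKp.le (by
    rw [le_div_iff₀ hM0]; exact mul_le_mul_of_nonneg_left hML hKp.le)
  have fL := fin (volume L).toReal hLp.le (by
    rw [le_div_iff₀ hM0, mul_comm]; exact mul_le_mul_of_nonneg_right hMK hLp.le)
  rw [ge_iff_le]
  linarith
end

section
/- Let p > 0, α > 0, let K ⊆ ℝ^n be a convex body with 0 ∈ K, and let g : K → [0,∞) be a continuous α-concave function with ‖g‖_∞ = g(0) > 0 and g = 0 on ∂K (extended by 0 outside K). Then for every t ∈ [0, pα/(1+pα)^{1+1/(pα)}], the inclusion t·binom(p + 1/α, p)^(1/p)·K_p(g) ⊆ L_{1−t}(g) holds. -/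
open MeasureTheory Set Pointwise

variable {n : ℕ}

/-- Ball's body `K_p(g) = {x : p ∫_0^∞ r^{p-1} g(rx) dr ≥ g(0)}`. -/
noncomputable def ballBody (g : EuclideanSpace ℝ (Fin n) → ℝ) (p : ℝ) :
    Set (EuclideanSpace ℝ (Fin n)) :=
  {x | g 0 ≤ p * ∫ r in Set.Ioi (0:ℝ), r ^ (p - 1) * g (r • x)}

/-- The generalized binomial coefficient `binom(x,y) = Γ(1+x)/(Γ(1+y)Γ(1+x-y))`. -/
noncomputable def gbinom (x y : ℝ) : ℝ :=
  Real.Gamma (1 + x) / (Real.Gamma (1 + y) * Real.Gamma (1 + x - y))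

lemma aux_beta {a b : ℝ} (ha : 0 < a) (hb : 0 < b) :
    IntervalIntegrable (fun τ : ℝ => τ ^ (a-1) * (1-τ) ^ (b-1)) volume 0 1 ∧
    ∫ τ in (0:ℝ)..1, τ ^ (a-1) * (1-τ) ^ (b-1) = ProbabilityTheory.beta a b := by
  have hc := Complex.betaIntegral_convergent (u := a) (v := b) (by simpa) (by simpa)
  rw [intervalIntegrable_iff_integrableOn_Ioc_of_le (by simp)] at hc
  have e : ∀ x ∈ Ioc (0:ℝ) 1, RCLike.re ((x:ℂ) ^ ((a:ℂ) - 1) * (1 - (x:ℂ)) ^ ((b:ℂ) - 1))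
      = x ^ (a-1) * (1-x) ^ (b-1) := by
    intro x ⟨hx1, hx2⟩
    norm_cast
    rw [← Complex.ofReal_cpow, ← Complex.ofReal_cpow, RCLike.re_to_complex,
        Complex.re_mul_ofReal, Complex.ofReal_re]
    all_goals linarith
  constructor
  · rw [intervalIntegrable_iff_integrableOn_Ioc_of_le (by simp)]
    exact IntegrableOn.congr_fun (Integrable.re hc) e measurableSet_Ioc
  · rw [ProbabilityTheory.beta_eq_betaIntegralReal a b ha hb, Complex.betaIntegral,
      intervalIntegral.integral_of_le (by norm_num), intervalIntegral.integral_of_le (by norm_num),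
      ← RCLike.re_to_complex, ← integral_re hc]
    exact (setIntegral_congr_fun measurableSet_Ioc e).symm

lemma aux_beta_succ {p b : ℝ} (hp : 0 < p) (hb : 0 < b) :
    ProbabilityTheory.beta (p+1) b = p / (p+b) * ProbabilityTheory.beta p b := by
  unfold ProbabilityTheory.beta
  rw [Real.Gamma_add_one hp.ne', show p + 1 + b = (p+b)+1 by ring,
    Real.Gamma_add_one (by positivity)]
  have := Real.Gamma_pos_of_pos (show 0 < p + b by positivity)
  field_simp

lemma aux_int1 {b : ℝ} (hb : 0 < b) :
    IntervalIntegrable (fun τ : ℝ => (1-τ) ^ (b-1)) volume 0 1 := by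
  have := (aux_beta (a := 1) one_pos hb).1
  simpa using this

lemma aux_int1_tail {a b : ℝ} (hb : 0 < b) (ha : a ≤ 1) :
    ∫ τ in a..1, (1-τ) ^ (b-1) = (1-a)^b / b := by
  rw [intervalIntegral.integral_comp_sub_left (fun x => x ^ (b-1)) 1, integral_rpow (by left; linarith)]
  simp [hb.ne']

lemma aux_markov {p b : ℝ} (hp : 0 < p) (hb : 0 < b) {a : ℝ} (ha0 : 0 ≤ a) (ha : a ≤ 1) :
    a ^ p * (1-a)^b ≤ b * ProbabilityTheory.beta (p+1) b := by
  obtain ⟨hi, he⟩ := aux_beta (a := p+1) (b := b) (by linarith) hb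
  rw [add_sub_cancel_right] at hi he
  have hs1 : uIcc 0 a ⊆ uIcc (0:ℝ) 1 := by
    rw [uIcc_of_le ha0, uIcc_of_le zero_le_one]; exact Icc_subset_Icc_right ha
  have hs2 : uIcc a 1 ⊆ uIcc (0:ℝ) 1 := by
    rw [uIcc_of_le ha, uIcc_of_le zero_le_one]; exact Icc_subset_Icc_left ha0
  have h1 := hi.mono_set hs1
  have h2 := hi.mono_set hs2
  rw [← intervalIntegral.integral_add_adjacent_intervals h1 h2] at he
  have h3 : 0 ≤ ∫ τ in (0:ℝ)..a, τ ^ p * (1-τ) ^ (b-1) := by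
    apply intervalIntegral.integral_nonneg ha0
    intro x hx
    have : 0 ≤ 1 - x := by linarith [hx.2]
    have := hx.1
    positivity
  have h4 : a ^ p * ((1-a)^b / b) ≤ ∫ τ in a..1, τ ^ p * (1-τ) ^ (b-1) := by
    rw [← aux_int1_tail hb ha, ← intervalIntegral.integral_const_mul]
    apply intervalIntegral.integral_mono_on ha (((aux_int1 hb).mono_set hs2).const_mul _) h2
    intro x hx
    have : 0 ≤ 1 - x := by linarith [hx.2]
    have := hx.1
    gcongr
  rw [← he]
  calc a ^ p * (1-a)^b = b * (a ^ p * ((1-a)^b / b)) := by field_simp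
    _ ≤ _ := by gcongr; linarith

lemma aux_int_gen {b : ℝ} (hb : 0 < b) {f : ℝ → ℝ} (hf : Continuous f) :
    IntervalIntegrable (fun τ : ℝ => f τ * (1-τ) ^ (b-1)) volume 0 1 :=
  (aux_int1 hb).continuousOn_mul hf.continuousOn

lemma aux_key0 {p b t l : ℝ} (hp : 0 < p) (hb : 0 < b) (ht0 : 0 < t) (ht : t ≤ p / (p+b))
    (ht2 : t ^ p ≤ b * ProbabilityTheory.beta (p+1) b) (hl : 0 ≤ l) (hl1 : l ≤ 1) :
    ∫ τ in (0:ℝ)..1, (l * t + (1-l) * τ) ^ p * (1-τ) ^ (b-1) ≤ ProbabilityTheory.beta (p+1) b := by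
  obtain ⟨hi, he⟩ := aux_beta (a := p+1) (b := b) (by linarith) hb
  rw [add_sub_cancel_right] at hi he
  have hL : IntervalIntegrable (fun τ : ℝ => (l * t + (1-l) * τ) ^ p * (1-τ) ^ (b-1)) volume 0 1 := by
    apply aux_int_gen hb
    exact Continuous.rpow_const (by fun_prop) (fun _ => Or.inr hp.le)
  rcases le_total 1 p with h1 | h1
  · calc _ ≤ ∫ τ in (0:ℝ)..1, (l * t^p * (1-τ) ^ (b-1) + (1-l) * (τ ^ p * (1-τ) ^ (b-1))) := by
          apply intervalIntegral.integral_mono_on zero_le_one hL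
            (((aux_int1 hb).const_mul _).add (hi.const_mul _))
          intro x hx
          have h0 : 0 ≤ 1 - x := by linarith [hx.2]
          have := (convexOn_rpow h1).2 (x := t) ht0.le (y := x) hx.1 hl (sub_nonneg.2 hl1) (by ring)
          simp only [smul_eq_mul] at this
          calc _ ≤ (l * t^p + (1-l) * x^p) * (1-x)^(b-1) := by gcongr
            _ = _ := by ring
      _ = l * (t^p / b) + (1-l) * ProbabilityTheory.beta (p+1) b := by
          rw [intervalIntegral.integral_add ((aux_int1 hb).const_mul _) (hi.const_mul _),
            intervalIntegral.integral_const_mul, intervalIntegral.integral_const_mul, he,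
            aux_int1_tail hb zero_le_one]
          simp; ring
      _ ≤ l * ProbabilityTheory.beta (p+1) b + (1-l) * ProbabilityTheory.beta (p+1) b := by
          gcongr
          rw [div_le_iff₀ hb]; linarith
      _ = _ := by ring
  · obtain ⟨hi', he'⟩ := aux_beta (a := p) (b := b) hp hb
    have hB := ProbabilityTheory.beta_pos hp hb
    calc _ ≤ ∫ τ in (0:ℝ)..1, ((1 - p * l) * (τ ^ p * (1-τ) ^ (b-1)) + p * l * t * (τ ^ (p-1) * (1-τ) ^ (b-1))) := by
          apply intervalIntegral.integral_mono_on_of_le_Ioo zero_le_one hL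
            ((hi.const_mul _).add (hi'.const_mul _))
          intro x hx
          have h0 : 0 ≤ 1 - x := by linarith [hx.2]
          have hx0 := hx.1
          have hs : -1 ≤ l * (t - x) / x := by
            rw [le_div_iff₀ hx0]; nlinarith
          have := rpow_one_add_le_one_add_mul_self hs hp.le h1
          have e1 : l * t + (1-l) * x = x * (1 + l * (t-x)/x) := by field_simp; ring
          rw [e1, Real.mul_rpow hx0.le (by linarith)]
          calc _ ≤ x^p * (1 + p * (l * (t-x)/x)) * (1-x)^(b-1) := by gcongr
            _ = _ := by
              rw [Real.rpow_sub_one hx0.ne']; field_simp; ring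
      _ = (1-p*l) * ProbabilityTheory.beta (p+1) b + p * l * t * ProbabilityTheory.beta p b := by
          rw [intervalIntegral.integral_add (hi.const_mul _) (hi'.const_mul _),
            intervalIntegral.integral_const_mul, intervalIntegral.integral_const_mul, he, he']
      _ ≤ (1-p*l) * ProbabilityTheory.beta (p+1) b + p * l * (p/(p+b)) * ProbabilityTheory.beta p b := by
          gcongr
      _ = _ := by rw [aux_beta_succ hp hb]; ring

lemma aux_key {p b t u w c : ℝ} (hp : 0 < p) (hb : 0 < b) (ht0 : 0 < t) (ht : t ≤ p / (p+b))
    (ht2 : t ^ p ≤ b * ProbabilityTheory.beta (p+1) b) (hu : 0 ≤ u) (hw : 0 < w)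
    (hc : u + w * t = t * c) :
    ∫ τ in (0:ℝ)..1, (u + w * τ) ^ p * (1-τ) ^ (b-1) ≤ c ^ p * ProbabilityTheory.beta (p+1) b := by
  have hc0 : 0 < c := by
    have : 0 < t * c := by rw [← hc]; positivity
    exact (mul_pos_iff_of_pos_left ht0).1 this
  have hw1 : w = c * (1 - u/(t*c)) := by field_simp; linarith
  have hl1 : u / (t*c) ≤ 1 := by
    rw [div_le_one (by positivity), ← hc]; have := mul_pos hw ht0; linarith
  have h := aux_key0 (l := u/(t*c)) hp hb ht0 ht ht2 (by positivity) hl1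
  calc _ = c ^ p * ∫ τ in (0:ℝ)..1, ((u/(t*c)) * t + (1-(u/(t*c))) * τ) ^ p * (1-τ) ^ (b-1) := by
        rw [← intervalIntegral.integral_const_mul]
        apply intervalIntegral.integral_congr
        intro x hx
        rw [uIcc_of_le zero_le_one] at hx
        have : u + w * x = c * ((u/(t*c)) * t + (1-(u/(t*c))) * x) := by
          rw [hw1]; field_simp
        simp only
        rw [this, Real.mul_rpow hc0.le]
        · ring
        · have := sub_nonneg.2 hl1
          have := hx.1
          positivity
    _ ≤ _ := by gcongr

lemma aux_parts {p b u w : ℝ} (hp : 0 < p) (hb : 0 < b) (hu : 0 ≤ u) (hw : 0 < w) :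
    u ^ p + p * ∫ r in u..(u+w), r ^ (p-1) * (1 - (r-u)/w) ^ b =
     b * ∫ τ in (0:ℝ)..1, (u + w * τ) ^ p * (1-τ) ^ (b-1) := by
  have hsub := intervalIntegral.smul_integral_comp_add_mul (a := 0) (b := 1)
    (fun r => r ^ (p-1) * (1 - (r-u)/w) ^ b) w u
  have hI1 : IntervalIntegrable (fun τ : ℝ => (u + w * τ) ^ (p-1) * (1-τ)^b) volume 0 1 := by
    apply IntervalIntegrable.mul_continuousOn
    · have := (intervalIntegral.intervalIntegrable_rpow' (a := u) (b := u+w) (r := p-1) (by linarith))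
      have := (this.comp_add_right u).comp_mul_left (c := w) 
      simpa [hw.ne', add_comm] using this
    · exact (Continuous.rpow_const (by fun_prop) (fun _ => Or.inr hb.le)).continuousOn
  have hI2 : IntervalIntegrable (fun τ : ℝ => (u + w * τ) ^ p * (1-τ) ^ (b-1)) volume 0 1 := by
    apply aux_int_gen hb
    exact Continuous.rpow_const (by fun_prop) (fun _ => Or.inr hp.le)
  have h := intervalIntegral.integral_eq_sub_of_hasDerivAt_of_le (a := 0) (b := 1)
    (f := fun τ : ℝ => (u + w * τ) ^ p * (1-τ) ^ b)
    (f' := fun τ : ℝ => p * w * ((u + w * τ) ^ (p-1) * (1-τ)^b) - b * ((u + w * τ) ^ p * (1-τ) ^ (b-1)))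
    zero_le_one
    (((Continuous.rpow_const (by fun_prop) (fun _ => Or.inr hp.le)).mul
      (Continuous.rpow_const (by fun_prop) (fun _ => Or.inr hb.le))).continuousOn)
    (by
      intro x hx
      have hx0 := hx.1
      have hx1 := hx.2
      have d1 : HasDerivAt (fun τ : ℝ => u + w * τ) w x := by
        simpa using ((hasDerivAt_id x).const_mul w).const_add u
      have d2 : HasDerivAt (fun τ : ℝ => 1 - τ) (-1) x := by
        simpa using (hasDerivAt_id x).const_sub 1
      have := (d1.rpow_const (p := p) (Or.inl (by positivity))).mul
        (d2.rpow_const (p := b) (Or.inl (by linarith)))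
      convert! this using 1
      ring)
    ((hI1.const_mul _).sub (hI2.const_mul _))
  rw [intervalIntegral.integral_sub (hI1.const_mul _) (hI2.const_mul _),
    intervalIntegral.integral_const_mul, intervalIntegral.integral_const_mul] at h
  simp only [mul_zero, add_zero, mul_one, smul_eq_mul] at hsub
  rw [← hsub]
  have e : ∀ x, (1 - (u + w * x - u)/w) = 1 - x := by intro x; field_simp; ring
  simp only [e]
  simp [hb.ne', Real.zero_rpow] at h
  linarith

lemma aux_subgrad {S : Set ℝ} {f : ℝ → ℝ} (hf : ConcaveOn ℝ S f) {s : ℝ} (hs : s ∈ interior S) :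
    ∃ m : ℝ, ∀ r ∈ S, f r ≤ f s - m * (r - s) := by
  have hf' := hf.neg
  refine ⟨derivWithin (-f) (Ioi s) s, fun r hr => ?_⟩
  rcases lt_trichotomy r s with h | h | h
  · have h1 := hf'.slope_le_leftDeriv_of_mem_interior hr hs h
    have h2 := hf'.leftDeriv_le_rightDeriv_of_mem_interior hs
    have h3 := h1.trans h2
    rw [slope_def_field, div_le_iff₀ (by linarith)] at h3
    simp only [Pi.neg_apply] at h3
    linarith
  · subst h; simp
  · have h3 := hf'.rightDeriv_le_slope_of_mem_interior hs hr h
    rw [slope_def_field, le_div_iff₀ (by linarith)] at h3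
    simp only [Pi.neg_apply] at h3
    linarith

lemma aux_bound {p b u w : ℝ} (hp : 0 < p) (hb : 0 < b) (hu : 0 ≤ u) (hw : 0 < w) {h : ℝ → ℝ}
    (hint : IntegrableOn (fun r => r ^ (p-1) * h r) (Ioi 0))
    (h1 : ∀ r, h r ≤ 1) (h2 : ∀ r, u ≤ r → r ≤ u + w → h r ≤ (1 - (r-u)/w) ^ b)
    (h3 : ∀ r, u + w < r → h r = 0) :
    p * ∫ r in Ioi (0:ℝ), r ^ (p-1) * h r ≤
      u ^ p + p * ∫ r in u..(u+w), r ^ (p-1) * (1 - (r-u)/w) ^ b := by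
  have hi : ∀ x y : ℝ, 0 ≤ x → x ≤ y → IntervalIntegrable (fun r => r ^ (p-1) * h r) volume x y := by
    intro x y hx hxy
    rw [intervalIntegrable_iff_integrableOn_Ioc_of_le hxy]
    exact hint.mono_set (fun r hr => lt_of_le_of_lt hx hr.1)
  have e1 : ∫ r in Ioi (0:ℝ), r ^ (p-1) * h r = ∫ r in (0:ℝ)..(u+w), r ^ (p-1) * h r := by
    rw [intervalIntegral.integral_of_le (by positivity)]
    refine (setIntegral_eq_of_subset_of_forall_diff_eq_zero measurableSet_Ioi
      Ioc_subset_Ioi_self ?_)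
    intro r hr
    have : u + w < r := by
      by_contra hc
      exact hr.2 ⟨hr.1, not_lt.1 hc⟩
    rw [h3 r this, mul_zero]
  have a1 := hi 0 u le_rfl hu
  have a2 := hi u (u+w) hu (by linarith)
  rw [e1, ← intervalIntegral.integral_add_adjacent_intervals a1 a2]
  have hr : ∀ x y : ℝ, IntervalIntegrable (fun r : ℝ => r ^ (p-1)) volume x y := fun x y =>
    intervalIntegral.intervalIntegrable_rpow' (by linarith)
  have b1 : ∫ r in (0:ℝ)..u, r ^ (p-1) * h r ≤ u ^ p / p := by
    calc _ ≤ ∫ r in (0:ℝ)..u, r ^ (p-1) := by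
          apply intervalIntegral.integral_mono_on hu a1 (hr _ _)
          intro r hr
          have := hr.1
          calc _ ≤ r ^ (p-1) * 1 := by gcongr; exact h1 r
            _ = _ := mul_one _
      _ = _ := by
          rw [integral_rpow (by left; linarith)]
          simp [hp.ne']
  have b2 : ∫ r in u..(u+w), r ^ (p-1) * h r ≤ ∫ r in u..(u+w), r ^ (p-1) * (1 - (r-u)/w) ^ b := by
    apply intervalIntegral.integral_mono_on (by linarith) a2
    · exact (hr _ _).mul_continuousOn
        (Continuous.rpow_const (by fun_prop) (fun _ => Or.inr hb.le)).continuousOn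
    · intro r hr
      have : 0 ≤ r := hu.trans hr.1
      gcongr
      exact h2 r hr.1 hr.2
  calc _ ≤ p * (u^p/p + ∫ r in u..(u+w), r ^ (p-1) * (1 - (r-u)/w) ^ b) := by gcongr
    _ = _ := by field_simp

lemma aux_const {p α : ℝ} (hp : 0 < p) (hα : 0 < α) :
    p * α / (1 + p * α) ^ (1 + 1/(p*α)) ≤ p / (p + 1/α) ∧
    (p * α / (1 + p * α) ^ (1 + 1/(p*α))) ^ p ≤ 1/α * ProbabilityTheory.beta (p+1) (1/α) := by
  have hq : 0 < p * α := by positivity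
  have e : p / (p+1/α) = p * α / (1 + p*α) := by field_simp; ring
  have e2 : 1 - p / (p+1/α) = (1 + p*α)⁻¹ := by rw [e]; field_simp; ring
  have e3 : p * α / (1 + p * α) ^ (1 + 1/(p*α)) = p / (p+1/α) * ((1+p*α) ^ (1/(p*α)))⁻¹ := by
    rw [e, Real.rpow_add (by positivity), Real.rpow_one]; field_simp
  constructor
  · rw [e3]
    apply mul_le_of_le_one_right (by positivity)
    apply inv_le_one_of_one_le₀
    exact Real.one_le_rpow (by linarith) (by positivity)
  · refine le_trans (le_of_eq ?_) (aux_markov hp (b := 1/α) (by positivity) (a := p / (p+1/α)) (by positivity) ?_)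
    · rw [e2, e3, Real.mul_rpow (by positivity) (by positivity), Real.inv_rpow (by positivity),
        Real.inv_rpow (by positivity), ← Real.rpow_mul (by positivity)]
      congr 3
      field_simp
    · rw [div_le_one (by positivity)]
      have : 0 < 1/α := by positivity
      linarith

lemma aux_gbinom {p α : ℝ} (hp : 0 < p) (hα : 0 < α) :
    0 < gbinom (p + 1/α) p ∧
      gbinom (p + 1/α) p * (1/α * ProbabilityTheory.beta (p+1) (1/α)) = 1 := by
  have hb : 0 < 1/α := by positivity
  unfold gbinom ProbabilityTheory.beta
  rw [show 1 + (p+1/α) - p = 1/α + 1 by ring, Real.Gamma_add_one hb.ne', add_comm 1 p,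
    show 1 + (p+1/α) = p + 1 + 1/α by ring]
  have h1 := Real.Gamma_pos_of_pos hb
  have h2 := Real.Gamma_pos_of_pos (show 0 < p + 1 by positivity)
  have h3 := Real.Gamma_pos_of_pos (show 0 < p + 1 + 1/α by positivity)
  constructor
  · positivity
  · generalize 1/α = b at *
    field_simp

theorem ballBody_subset_superlevel (p α : ℝ) (hp : 0 < p) (hα : 0 < α)
    (K : Set (EuclideanSpace ℝ (Fin n))) (hK : IsConvexBody K) (h0K : (0 : EuclideanSpace ℝ (Fin n)) ∈ K)
    (g : EuclideanSpace ℝ (Fin n) → ℝ) (hg0 : ∀ x, 0 ≤ g x)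
    (hcont : ContinuousOn g K) (hconc : ConcaveOn ℝ K (fun x => g x ^ α))
    (hsup : (⨆ x, g x) = g 0) (hgpos : 0 < g 0)
    (hbd : ∀ x ∈ frontier K, g x = 0) (hout : ∀ x ∉ K, g x = 0)
    (t : ℝ) (ht : t ∈ Icc 0 (p * α / (1 + p * α) ^ (1 + 1/(p*α)))) :
    (t * gbinom (p + 1/α) p ^ (1/p)) • ballBody g p ⊆
      {x ∈ Function.support g | (1 - t) ^ (1/α) * g 0 ≤ g x} := by
  have hb : 0 < 1/α := by positivity
  obtain ⟨hc1, hc2⟩ := aux_const hp hα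
  obtain ⟨hG, hGe⟩ := aux_gbinom hp hα
  have ht0 := ht.1
  have hta : t ≤ p / (p + 1/α) := ht.2.trans hc1
  have htp : t ^ p ≤ 1/α * ProbabilityTheory.beta (p+1) (1/α) :=
    (Real.rpow_le_rpow ht0 ht.2 hp.le).trans hc2
  have ht1 : t < 1 := hta.trans_lt (by rw [div_lt_one (by positivity)]; linarith)
  set c := gbinom (p + 1/α) p ^ (1/p) with hcdef
  have hc : 0 < c := by positivity
  have hcp : c ^ p = gbinom (p + 1/α) p := by
    rw [hcdef, ← Real.rpow_mul hG.le, one_div_mul_cancel hp.ne', Real.rpow_one]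
  -- global continuity
  have hgc : Continuous g := by
    classical
    have hcl : closure K = K := hK.1.isClosed.closure_eq
    have := continuous_piecewise (s := K) (f := g) (g := fun _ => (0:ℝ)) hbd (by rwa [hcl])
      continuousOn_const
    convert! this using 1
    ext x
    by_cases hx : x ∈ K
    · simp [hx]
    · simp [hx, hout x hx]
  -- boundedness
  have hle : ∀ x, g x ≤ g 0 := by
    obtain ⟨M, hM⟩ := (hK.1.image_of_continuousOn hcont).bddAbove
    have hbdd : BddAbove (range g) := by
      refine ⟨max M 0, ?_⟩
      rintro _ ⟨x, rfl⟩
      by_cases hx : x ∈ K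
      · exact le_max_of_le_left (hM ⟨x, hx, rfl⟩)
      · rw [hout x hx]; exact le_max_right _ _
    intro x
    rw [← hsup]
    exact le_ciSup hbdd x
  rintro _ ⟨x, hx, rfl⟩
  have hx' : g 0 ≤ p * ∫ r in Set.Ioi (0:ℝ), r ^ (p - 1) * g (r • x) := hx
  set h : ℝ → ℝ := fun r => g (r • x) / g 0 with hh
  have hh0 : ∀ r, 0 ≤ h r := fun r => div_nonneg (hg0 _) hgpos.le
  have hh1 : ∀ r, h r ≤ 1 := fun r => (div_le_one hgpos).2 (hle _)
  have hhc : Continuous h := by fun_prop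
  suffices hmain : 1 - t ≤ (h (t * c)) ^ α by
    have h1 : (1-t) ^ (1/α) ≤ h (t*c) := by
      have := Real.rpow_le_rpow (by linarith) hmain hb.le
      rwa [← Real.rpow_mul (hh0 _), mul_one_div_cancel hα.ne', Real.rpow_one] at this
    have h2 : (1-t) ^ (1/α) * g 0 ≤ g ((t*c) • x) := by
      rwa [hh, le_div_iff₀ hgpos] at h1
    have h3 : 0 < (1-t) ^ (1/α) * g 0 := by
      have : 0 < 1 - t := by linarith
      positivity
    exact ⟨(h3.trans_le h2).ne', h2⟩
  by_contra hcon
  push Not at hcon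
  have hint : IntegrableOn (fun r => r ^ (p-1) * h r) (Ioi 0) := by
    have : IntegrableOn (fun r => r ^ (p-1) * g (r • x)) (Ioi 0) := by
      by_contra hn
      rw [integral_undef hn] at hx'
      linarith
    have := this.div_const (g 0)
    simpa [hh, mul_div_assoc] using! this
  have hone : 1 ≤ p * ∫ r in Ioi (0:ℝ), r ^ (p-1) * h r := by
    have : ∫ r in Ioi (0:ℝ), r ^ (p-1) * h r = (∫ r in Ioi (0:ℝ), r ^ (p-1) * g (r • x)) / g 0 := by
      rw [← integral_div]
      simp only [hh, mul_div_assoc]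
    rw [this, ← mul_div_assoc, le_div_iff₀ hgpos]
    linarith
  set φ : ℝ → ℝ := fun r => h r ^ α with hφ
  have hφc : Continuous φ := hhc.rpow_const (fun _ => Or.inr hα.le)
  have hφ00 : φ 0 = 1 := by simp [hφ, hh, hgpos.ne']
  have hφ0 : ∀ r, 0 ≤ φ r := fun r => Real.rpow_nonneg (hh0 r) _
  have hφh : ∀ r, h r = φ r ^ (1/α) := by
    intro r
    rw [hφ]; simp only
    rw [← Real.rpow_mul (hh0 _), mul_one_div_cancel hα.ne', Real.rpow_one]
  set S : Set ℝ := {r | r • x ∈ K} with hS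
  have hφS : ConcaveOn ℝ S φ := by
    have h1 := hconc.comp_linearMap (LinearMap.toSpanSingleton ℝ _ x)
    have h2 := h1.smul (c := (g 0 ^ α)⁻¹) (by positivity)
    convert! h2 using 1
    ext r
    simp [hφ, hh, Real.div_rpow (hg0 _) hgpos.le]
    ring
  have hout' : ∀ r, r ∉ S → φ r = 0 := by
    intro r hr
    simp [hφ, hh, hout _ hr, hα.ne']
  have htpos : 0 < t := by
    rcases ht0.lt_or_eq with h | h
    · exact h
    · exfalso
      rw [← h] at hcon
      simp [hh, hgpos.ne'] at hcon
  have hs0 : 0 ≤ t * c := by positivity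
  have hφs := hφ0 (t*c)
  have hcon' : φ (t*c) < 1 - t := hcon
  obtain ⟨s, hs, hsy⟩ := intermediate_value_Icc' hs0 hφc.continuousOn
    (show (φ (t*c) + (1-t))/2 ∈ Icc (φ (t*c)) (φ 0) by
      rw [hφ00]; constructor <;> linarith)
  set y := (φ (t*c) + (1-t))/2 with hy
  have hy0 : 0 < y := by linarith
  have hy1 : y < 1 - t := by linarith
  have hsint : s ∈ interior S := by
    rw [mem_interior]
    refine ⟨{r | 0 < φ r}, ?_, isOpen_lt continuous_const hφc, ?_⟩
    · intro r hr
      by_contra hn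
      have : 0 < φ r := hr
      rw [hout' r hn] at this
      exact lt_irrefl _ this
    · show 0 < φ s
      rwa [hsy]
  obtain ⟨m, hm⟩ := aux_subgrad hφS hsint
  rw [hsy] at hm
  have h0S : (0:ℝ) ∈ S := by simpa [hS] using h0K
  have hm0 := hm 0 h0S
  rw [hφ00] at hm0
  have hspos : 0 < s := by
    rcases hs.1.lt_or_eq with h | h
    · exact h
    · rw [← h] at hm0; linarith
  have hmpos : 0 < m := by
    by_contra hn
    nlinarith [mul_nonneg (neg_nonneg.2 (not_lt.1 hn)) hspos.le]
  have hu : 0 ≤ s - (1-y)/m := by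
    rw [sub_nonneg, div_le_iff₀ hmpos]; linarith
  set u := s - (1-y)/m with hudef
  have hw : 0 < 1/m := by positivity
  have hline : ∀ r, y - m * (r - s) = 1 - (r-u)/(1/m) := by
    intro r; rw [hudef]; field_simp; ring
  have hB := aux_bound hp hb hu hw hint hh1
    (by
      intro r h1 h2
      rw [hφh r]
      have hnn : 0 ≤ 1 - (r-u)/(1/m) := by
        rw [sub_nonneg, div_le_one hw]; linarith
      apply Real.rpow_le_rpow (hφ0 r) _ hb.le
      by_cases hr : r ∈ S
      · rw [← hline]; exact hm r hr
      · rw [hout' r hr]; exact hnn)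
    (by
      intro r h1
      rw [hφh r, hout' r, Real.zero_rpow hb.ne']
      intro hr
      have h2 := hm r hr
      rw [hline] at h2
      have : 1 < (r-u)/(1/m) := by rw [one_lt_div hw]; linarith
      linarith [hφ0 r])
  rw [aux_parts hp hb hu hw] at hB
  have hK2 := aux_key (c := (u + 1/m*t)/t) hp hb htpos hta htp hu hw (by field_simp)
  have hlt : (u + 1/m*t)/t < c := by
    rw [div_lt_iff₀ htpos]
    have e : u + 1/m*(1-y) = s := by rw [hudef]; ring
    have : 1/m * t < 1/m * (1-y) := by gcongr; linarith
    linarith [hs.2]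
  have hlt2 : ((u + 1/m*t)/t)^p < c^p := Real.rpow_lt_rpow (by positivity) hlt hp
  have hbeta : 0 < 1/α * ProbabilityTheory.beta (p+1) (1/α) :=
    mul_pos hb (ProbabilityTheory.beta_pos (by positivity) hb)
  have hfin : 1/α * (((u + 1/m*t)/t)^p * ProbabilityTheory.beta (p+1) (1/α)) < 1 := by
    calc _ = ((u + 1/m*t)/t)^p * (1/α * ProbabilityTheory.beta (p+1) (1/α)) := by ring
      _ < c^p * (1/α * ProbabilityTheory.beta (p+1) (1/α)) := by gcongr
      _ = 1 := by rw [hcp, hGe]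
  have := mul_le_mul_of_nonneg_left hK2 hb.le
  linarith
end

section
/- Let g : ℝ^n → [0,∞) be an integrable log-concave function with ‖g‖_∞ = g(0) > 0. Then for any p > 0 and any 0 < t < p/e, the inclusion (t/Γ(1+p)^(1/p))·K_p(g) ⊆ {x ∈ ℝ^n : g(x) ≥ e^{−t}·‖g‖_∞} holds. -/
open MeasureTheory Set Pointwise
variable {n : ℕ}

lemma bb_gamma_int {q T : ℝ} (hq : 0 < q) (hT : 0 < T) :
    IntegrableOn (fun v : ℝ => Real.exp (-v) * (v / T) ^ (q - 1)) (Ioi 0) ∧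
    ∫ v in Ioi (0:ℝ), Real.exp (-v) * (v / T) ^ (q - 1) = Real.Gamma q / T ^ (q - 1) := by
  have h : EqOn (fun v : ℝ => Real.exp (-v) * (v / T) ^ (q - 1))
      (fun v => (Real.exp (-v) * v ^ (q - 1)) * (T ^ (q - 1))⁻¹) (Ioi 0) := by
    intro v hv
    have hv : 0 < v := hv
    simp only [Real.div_rpow hv.le hT.le]
    ring
  constructor
  · rw [integrableOn_congr_fun h measurableSet_Ioi]
    exact (Real.GammaIntegral_convergent hq).mul_const _
  · rw [setIntegral_congr_fun measurableSet_Ioi h, integral_mul_const, ← Real.Gamma_eq_integral hq]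
    rfl

lemma bb_gamma_lower {p : ℝ} (hp : 0 < p) : (p / Real.exp 1) ^ p ≤ Real.Gamma (p + 1) := by
  have h1 : (p / Real.exp 1) ^ p = ∫ v in Ioi p, Real.exp (-v) * p ^ p := by
    rw [integral_mul_const, integral_exp_neg_Ioi, Real.div_rpow hp.le (Real.exp_pos _).le,
      ← Real.exp_mul, one_mul, Real.exp_neg]
    field_simp
  have hi := Real.GammaIntegral_convergent (s := p + 1) (by linarith)
  rw [h1, Real.Gamma_eq_integral (by linarith)]
  simp only [add_sub_cancel_right] at hi ⊢
  have hs : Ioi p ⊆ Ioi 0 := Ioi_subset_Ioi hp.le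
  calc _ ≤ ∫ v in Ioi p, Real.exp (-v) * v ^ p := by
        apply setIntegral_mono_on ((integrableOn_exp_neg_Ioi p).mul_const _)
          (hi.mono_set hs) measurableSet_Ioi
        intro v hv
        have := Real.rpow_le_rpow hp.le (le_of_lt hv) hp.le
        gcongr
    _ ≤ _ := by
        apply setIntegral_mono_set hi _ hs.eventuallyLE
        rw [Filter.EventuallyLE, ae_restrict_iff' measurableSet_Ioi]
        filter_upwards with v hv
        have hv : 0 < v := hv
        simp only [Pi.zero_apply]
        positivity

lemma bb_mono_of_nonneg {f h : ℝ → ℝ} {c : ℝ} (hf : ∀ v ∈ Ioi c, 0 ≤ f v)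
    (hh : IntegrableOn h (Ioi c)) (hfh : ∀ v ∈ Ioi c, f v ≤ h v) :
    ∫ v in Ioi c, f v ≤ ∫ v in Ioi c, h v := by
  apply integral_mono_of_nonneg _ hh
  · exact (ae_restrict_iff' measurableSet_Ioi).2 (Filter.Eventually.of_forall hfh)
  · exact (ae_restrict_iff' measurableSet_Ioi).2 (Filter.Eventually.of_forall hf)

lemma bb_lemmaA {p T l : ℝ} (hp : 0 < p) (hT : 0 < T) (hTp : T ≤ p / Real.exp 1)
    (hl0 : 0 ≤ l) (hl1 : l ≤ 1) :
    ∫ v in Ioi (0:ℝ), Real.exp (-v) * ((1 - l) + l * (v / T)) ^ p ≤ Real.Gamma (p + 1) / T ^ p := by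
  obtain ⟨i1, e1⟩ := bb_gamma_int (q := p + 1) (T := T) (by linarith) hT
  obtain ⟨i2, e2⟩ := bb_gamma_int (q := p) (T := T) (by linarith) hT
  simp only [add_sub_cancel_right] at i1 e1
  have hTpp : 0 < T ^ p := by positivity
  have hpos : ∀ v ∈ Ioi (0:ℝ), 0 ≤ Real.exp (-v) * ((1 - l) + l * (v / T)) ^ p := by
    intro v hv
    have hv : 0 < v := hv
    have : 0 ≤ 1 - l := by linarith
    positivity
  have hTp' : T ≤ p := hTp.trans (div_le_self hp.le (Real.one_le_exp zero_le_one))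
  rcases le_total 1 p with h1 | h1
  · have h1G : 1 ≤ Real.Gamma (p + 1) / T ^ p := by
      rw [le_div_iff₀ hTpp, one_mul]
      exact (Real.rpow_le_rpow hT.le hTp hp.le).trans (bb_gamma_lower hp)
    have i0 : IntegrableOn (fun v : ℝ => Real.exp (-v)) (Ioi 0) := integrableOn_exp_neg_Ioi 0
    have hb : IntegrableOn (fun v : ℝ => Real.exp (-v) * (1 - l) +
        (Real.exp (-v) * (v / T) ^ p) * l) (Ioi 0) :=
      (i0.mul_const _).add (i1.mul_const _)
    refine (bb_mono_of_nonneg hpos hb ?_).trans ?_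
    · intro v hv
      have hv : 0 < v := hv
      have := (convexOn_rpow h1).2 (x := 1) (y := v / T) (by simp) (by simp; positivity)
        (show 0 ≤ 1 - l by linarith) hl0 (by ring)
      simp only [smul_eq_mul, mul_one, Real.one_rpow] at this
      have := mul_le_mul_of_nonneg_left this (Real.exp_pos (-v)).le
      linarith
    · rw [integral_add (i0.mul_const _) (i1.mul_const _), integral_mul_const, integral_mul_const,
        e1, integral_exp_neg_Ioi]
      simp only [neg_zero, Real.exp_zero, one_mul]
      nlinarith
  · have hb : IntegrableOn (fun v : ℝ => (Real.exp (-v) * (v / T) ^ p) * (1 - p * (1 - l)) +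
        (Real.exp (-v) * (v / T) ^ (p - 1)) * (p * (1 - l))) (Ioi 0) :=
      (i1.mul_const _).add (i2.mul_const _)
    refine (bb_mono_of_nonneg hpos hb ?_).trans ?_
    · intro v hv
      have hv : 0 < v := hv
      set z := v / T with hz
      have hz0 : 0 < z := by positivity
      have hs : -1 ≤ (1 - l) * (1 - z) / z := by
        rw [le_div_iff₀ hz0]; nlinarith
      have := rpow_one_add_le_one_add_mul_self hs hp.le h1
      have e : (1 - l) + l * z = z * (1 + (1 - l) * (1 - z) / z) := by field_simp; ring
      have e3 : z ^ p = z ^ (p - 1) * z := by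
        rw [← Real.rpow_add_one hz0.ne']; simp
      have h2 : ((1 - l) + l * z) ^ p ≤ z ^ p * (1 - p * (1 - l)) + z ^ (p - 1) * (p * (1 - l)) := by
        rw [e, Real.mul_rpow hz0.le (by linarith)]
        refine (mul_le_mul_of_nonneg_left this (by positivity)).trans (le_of_eq ?_)
        rw [e3]
        field_simp
        ring
      have := mul_le_mul_of_nonneg_left h2 (Real.exp_pos (-v)).le
      linarith
    · rw [integral_add (i1.mul_const _) (i2.mul_const _), integral_mul_const, integral_mul_const,
        e1, e2]
      have hBA : Real.Gamma p / T ^ (p - 1) ≤ Real.Gamma (p + 1) / T ^ p := by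
        rw [Real.Gamma_add_one hp.ne']
        have e3 : T ^ p = T ^ (p - 1) * T := by
          rw [← Real.rpow_add_one hT.ne']; simp
        have := Real.Gamma_pos_of_pos hp
        rw [e3, div_le_div_iff₀ (by positivity) (by positivity)]
        have h5 : 0 < T ^ (p - 1) := by positivity
        nlinarith [mul_pos this h5]
      have : 0 ≤ p * (1 - l) := mul_nonneg hp.le (by linarith)
      nlinarith

lemma bb_subst (F : ℝ → ℝ) {b : ℝ} (c : ℝ) (hb : 0 < b) :
    ∫ r in Ioi c, F r = b * ∫ v in Ioi (0:ℝ), F (b * v + c) := by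
  have h := integral_comp_mul_left_Ioi (fun u => F (u + c)) 0 hb
  simp only [mul_zero, smul_eq_mul] at h
  rw [h, ← mul_assoc, mul_inv_cancel₀ hb.ne', one_mul, ← integral_indicator measurableSet_Ioi,
    ← integral_indicator measurableSet_Ioi, ← integral_add_right_eq_self _ c]
  congr 1
  ext u
  simp [indicator]

/-- tail integral, by parts -/
lemma bb_tail {p m c : ℝ} (hp : 0 < p) (hm : 0 < m) (hc : 0 ≤ c) :
    IntegrableOn (fun r : ℝ => r ^ (p - 1) * Real.exp (-(m * (r - c)))) (Ioi c) ∧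
    c ^ p + p * ∫ r in Ioi c, r ^ (p - 1) * Real.exp (-(m * (r - c))) =
      ∫ v in Ioi (0:ℝ), Real.exp (-v) * (c + v / m) ^ p := by
  have key : ∀ q : ℝ, -1 < q →
      IntegrableOn (fun r : ℝ => r ^ q * Real.exp (-(m * (r - c)))) (Ioi c) := by
    intro q hq
    have h := (integrableOn_rpow_mul_exp_neg_mul_rpow hq zero_lt_one hm).mono_set
      (Ioi_subset_Ioi hc)
    have h : IntegrableOn (fun x : ℝ => x ^ q * Real.exp (-m * x ^ (1:ℝ)) * Real.exp (m * c))
      (Ioi c) := h.mul_const (Real.exp (m * c))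
    refine h.congr_fun ?_ measurableSet_Ioi
    intro r hr
    simp only [Real.rpow_one]
    rw [mul_assoc, ← Real.exp_add, show -m * r + m * c = -(m * (r - c)) by ring]
  have k1 := key (p - 1) (by linarith)
  have k2 := key p (by linarith)
  refine ⟨k1, ?_⟩
  have hF := integral_Ioi_of_hasDerivAt_of_tendsto (a := c) (m := 0)
    (f := fun r : ℝ => r ^ p * Real.exp (-(m * (r - c))))
    (f' := fun r : ℝ => (r ^ (p - 1) * Real.exp (-(m * (r - c)))) * p -
      (r ^ p * Real.exp (-(m * (r - c)))) * m) ?_ ?_ ((k1.mul_const _).sub (k2.mul_const _)) ?_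
  · rw [integral_sub (k1.mul_const _) (k2.mul_const _), integral_mul_const, integral_mul_const] at hF
    have hs := bb_subst (fun r : ℝ => r ^ p * Real.exp (-(m * (r - c)))) c (inv_pos.2 hm)
    have e : ∫ v in Ioi (0:ℝ), (m⁻¹ * v + c) ^ p * Real.exp (-(m * (m⁻¹ * v + c - c))) =
        ∫ v in Ioi (0:ℝ), Real.exp (-v) * (c + v / m) ^ p := by
      congr 1
      ext v
      rw [mul_comm]
      congr 2
      · field_simp; ring
      · ring
    rw [e] at hs
    rw [hs] at hF
    simp only [sub_self, mul_zero, neg_zero, Real.exp_zero, mul_one] at hF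
    rw [mul_right_comm, inv_mul_cancel₀ hm.ne', one_mul] at hF
    linarith
  · apply Continuous.continuousWithinAt
    have : Continuous fun r : ℝ => r ^ p := Real.continuous_rpow_const hp.le
    fun_prop
  · intro r hr
    have hr0 : 0 < r := lt_of_le_of_lt hc hr
    have h1 := Real.hasDerivAt_rpow_const (x := r) (p := p) (Or.inl hr0.ne')
    have h2 : HasDerivAt (fun r : ℝ => Real.exp (-(m * (r - c))))
        (Real.exp (-(m * (r - c))) * (-(m * 1))) r :=
      ((((hasDerivAt_id r).sub_const c).const_mul m).neg).exp
    refine (h1.mul h2).congr_deriv ?_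
    ring
  · have h := (tendsto_rpow_mul_exp_neg_mul_atTop_nhds_zero p m hm).mul_const (Real.exp (m * c))
    rw [zero_mul] at h
    refine h.congr ?_
    intro r
    rw [mul_assoc, ← Real.exp_add, show -m * r + m * c = -(m * (r - c)) by ring]

lemma bb_head {p c : ℝ} (hp : 0 < p) (hc : 0 ≤ c) :
    IntegrableOn (fun r : ℝ => r ^ (p - 1)) (Ioc 0 c) ∧
    p * ∫ r in Ioc 0 c, r ^ (p - 1) = c ^ p := by
  have h1 : IntervalIntegrable (fun r : ℝ => r ^ (p - 1)) volume 0 c :=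
    intervalIntegral.intervalIntegrable_rpow' (by linarith)
  refine ⟨(intervalIntegrable_iff_integrableOn_Ioc_of_le hc).1 h1, ?_⟩
  rw [← intervalIntegral.integral_of_le hc, integral_rpow (Or.inl (by linarith))]
  simp only [sub_add_cancel, Real.zero_rpow hp.ne', sub_zero]
  field_simp

lemma bb_one_dim (f : ℝ → ℝ) (h0 : f 0 = 1) (hnn : ∀ r, 0 ≤ f r) (hle : ∀ r, f r ≤ 1)
    (hlc : ∀ r r' a b : ℝ, 0 ≤ a → 0 ≤ b → a + b = 1 → f r ^ a * f r' ^ b ≤ f (a * r + b * r'))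
    (p t : ℝ) (hp : 0 < p) (ht : 0 < t) (htp : t < p / Real.exp 1)
    (hI : 1 ≤ p * ∫ r in Ioi (0:ℝ), r ^ (p - 1) * f r) :
    Real.exp (-t) ≤ f (t / Real.Gamma (1 + p) ^ (1 / p)) := by
  by_contra hcon
  push Not at hcon
  have hG : 0 < Real.Gamma (1 + p) := Real.Gamma_pos_of_pos (by linarith)
  set s := t / Real.Gamma (1 + p) ^ (1 / p) with hs
  have hs0 : 0 < s := by positivity
  have hsp : s ^ p = t ^ p / Real.Gamma (1 + p) := by
    rw [hs, Real.div_rpow ht.le (by positivity), ← Real.rpow_mul hG.le]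
    field_simp
    simp
  have hanti : ∀ r r' : ℝ, 0 ≤ r → r ≤ r' → f r' ≤ f r := by
    intro r r' hr hrr
    rcases hr.eq_or_lt with h | h
    · rw [← h, h0]; exact hle _
    have hr' : 0 < r' := by linarith
    rcases (hnn r').eq_or_lt with hz | hz
    · rw [← hz]; exact hnn _
    have h1 : r / r' ≤ 1 := (div_le_one hr').2 hrr
    have := hlc 0 r' (1 - r / r') (r / r') (by linarith) (by positivity) (by ring)
    rw [h0, Real.one_rpow, one_mul, mul_zero, zero_add, div_mul_cancel₀ _ hr'.ne'] at this
    refine le_trans ?_ this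
    have := Real.rpow_le_rpow_of_exponent_ge hz (hle r') h1
    rwa [Real.rpow_one] at this
  have hint : IntegrableOn (fun r : ℝ => r ^ (p - 1) * f r) (Ioi 0) := by
    by_contra hni
    rw [integral_undef hni] at hI
    linarith
  -- split at c
  have hsplit : ∀ c : ℝ, 0 ≤ c →
      p * ∫ r in Ioi (0:ℝ), r ^ (p - 1) * f r ≤ c ^ p + p * ∫ r in Ioi c, r ^ (p - 1) * f r := by
    intro c hc
    have hU : Ioi (0:ℝ) = Ioc 0 c ∪ Ioi c := (Ioc_union_Ioi_eq_Ioi hc).symm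
    have hi1 : IntegrableOn (fun r : ℝ => r ^ (p - 1) * f r) (Ioc 0 c) :=
      hint.mono_set Ioc_subset_Ioi_self
    have hi2 : IntegrableOn (fun r : ℝ => r ^ (p - 1) * f r) (Ioi c) :=
      hint.mono_set (Ioi_subset_Ioi hc)
    rw [hU, setIntegral_union (Ioc_disjoint_Ioi le_rfl) measurableSet_Ioi hi1 hi2, mul_add]
    obtain ⟨j1, j2⟩ := bb_head hp hc
    rw [← j2]
    gcongr p * ?_ + _
    apply setIntegral_mono_on hi1 j1 measurableSet_Ioc
    intro r hr
    have : 0 ≤ r ^ (p - 1) := Real.rpow_nonneg hr.1.le _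
    nlinarith [hle r]
  by_cases hz : ∀ r > s, f r = 0
  · have h1 := hsplit s hs0.le
    have h2 : ∫ r in Ioi s, r ^ (p - 1) * f r = 0 := by
      rw [setIntegral_congr_fun (g := fun _ => (0:ℝ)) measurableSet_Ioi
        (fun r hr => by simp [hz r hr])]
      simp
    rw [h2, mul_zero, add_zero, hsp] at h1
    have h3 : 1 ≤ t ^ p / Real.Gamma (1 + p) := hI.trans h1
    rw [le_div_iff₀ hG, one_mul, add_comm] at h3
    have h4 := bb_gamma_lower hp
    have h5 := Real.rpow_lt_rpow ht.le htp hp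
    linarith
  push Not at hz
  obtain ⟨r1, hr1, hfr1⟩ := hz
  have hfr1 : 0 < f r1 := lt_of_le_of_ne (hnn _) (Ne.symm hfr1)
  have hfs : ∀ r, 0 ≤ r → r ≤ s → 0 < f r := fun r hr hrs =>
    hfr1.trans_le (hanti r r1 hr (hrs.trans hr1.le))
  have hfs0 := hfs s hs0.le le_rfl
  -- supporting slope
  obtain ⟨m, hmA, hmB⟩ := exists_between_of_forall_le
    (s := {x : ℝ | ∃ r, 0 ≤ r ∧ r < s ∧ x = (Real.log (f r) - Real.log (f s)) / (s - r)})
    (t := {x : ℝ | ∃ r, s < r ∧ 0 < f r ∧ x = (Real.log (f s) - Real.log (f r)) / (r - s)})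
    ⟨_, 0, le_rfl, hs0, rfl⟩ ⟨_, r1, hr1, hfr1, rfl⟩ (by
      rintro _ ⟨r, hr, hrs, rfl⟩ _ ⟨r', hr', hf', rfl⟩
      have hfr := hfs r hr hrs.le
      have hd : 0 < r' - r := by linarith
      have h := hlc r r' ((r' - s) / (r' - r)) ((s - r) / (r' - r))
        (div_nonneg (by linarith) hd.le) (div_nonneg (by linarith) hd.le) (by field_simp; ring)
      have e : (r' - s) / (r' - r) * r + (s - r) / (r' - r) * r' = s := by field_simp; ring
      rw [e] at h
      have h := Real.log_le_log (by positivity) h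
      rw [Real.log_mul (by positivity) (by positivity), Real.log_rpow hfr, Real.log_rpow hf'] at h
      have h := mul_le_mul_of_nonneg_left h hd.le
      have e2 : (r' - r) * ((r' - s) / (r' - r) * Real.log (f r) +
          (s - r) / (r' - r) * Real.log (f r')) =
          (r' - s) * Real.log (f r) + (s - r) * Real.log (f r') := by field_simp
      rw [e2] at h
      rw [div_le_div_iff₀ (by linarith) (by linarith)]
      linarith)
  set T := min (-Real.log (f s)) (p / Real.exp 1) with hT
  have hlogs : Real.log (f s) < -t := by
    rw [Real.log_lt_iff_lt_exp hfs0]; exact hcon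
  have htT : t < T := lt_min (by linarith) htp
  have hT0 : 0 < T := ht.trans htT
  have hTp : T ≤ p / Real.exp 1 := min_le_right _ _
  have hTs : Real.log (f s) ≤ -T := by have := min_le_left (-Real.log (f s)) (p / Real.exp 1); linarith
  have hms : T ≤ m * s := by
    have := hmA ⟨0, le_rfl, hs0, rfl⟩
    rw [h0, Real.log_one, sub_zero, div_le_iff₀ hs0] at this
    linarith
  have hm : 0 < m := by
    by_contra h
    push Not at h
    nlinarith
  set c := s - T / m with hc
  have hc0 : 0 ≤ c := by
    have : T / m ≤ s := by rw [div_le_iff₀ hm]; linarith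
    linarith
  have hbound : ∀ r ∈ Ioi c, f r ≤ Real.exp (-(m * (r - c))) := by
    intro r hr
    have hr0 : 0 ≤ r := hc0.trans (le_of_lt hr)
    rcases (hnn r).eq_or_lt with hz | hfr
    · rw [← hz]; positivity
    rw [← Real.log_le_iff_le_exp hfr]
    have e : -(m * (r - c)) = -T - m * (r - s) := by rw [hc]; field_simp; ring
    rw [e]
    rcases lt_trichotomy r s with h | h | h
    · have := hmA ⟨r, hr0, h, rfl⟩
      rw [div_le_iff₀ (by linarith)] at this
      linarith
    · rw [h]; linarith
    · have := hmB ⟨r, h, hfr, rfl⟩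
      rw [le_div_iff₀ (by linarith)] at this
      linarith
  obtain ⟨k1, k2⟩ := bb_tail hp hm hc0
  have hfin : p * ∫ r in Ioi c, r ^ (p - 1) * f r ≤
      p * ∫ r in Ioi c, r ^ (p - 1) * Real.exp (-(m * (r - c))) := by
    refine mul_le_mul_of_nonneg_left ?_ hp.le
    apply setIntegral_mono_on (hint.mono_set (Ioi_subset_Ioi hc0)) k1 measurableSet_Ioi
    intro r hr
    exact mul_le_mul_of_nonneg_left (hbound r hr) (Real.rpow_nonneg (hc0.trans (le_of_lt hr)) _)
  have hA := bb_lemmaA (l := T / (m * s)) hp hT0 hTp (by positivity)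
    ((div_le_one (by positivity)).2 hms)
  have hl : 0 ≤ 1 - T / (m * s) := sub_nonneg.2 ((div_le_one (by positivity)).2 hms)
  have hE : ∫ v in Ioi (0:ℝ), Real.exp (-v) * (c + v / m) ^ p =
      s ^ p * ∫ v in Ioi (0:ℝ), Real.exp (-v) * ((1 - T / (m * s)) + T / (m * s) * (v / T)) ^ p := by
    rw [← integral_const_mul]
    apply setIntegral_congr_fun measurableSet_Ioi
    intro v hv
    have hv : 0 < v := hv
    have e : c + v / m = s * ((1 - T / (m * s)) + T / (m * s) * (v / T)) := by
      rw [hc]; field_simp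
    simp only
    rw [e, Real.mul_rpow hs0.le (by positivity)]
    ring
  have h1 := hsplit c hc0
  have h2 : 1 ≤ s ^ p * (Real.Gamma (p + 1) / T ^ p) := by
    have := mul_le_mul_of_nonneg_left hA (Real.rpow_nonneg hs0.le p)
    linarith
  have h3 := Real.rpow_lt_rpow ht.le htT hp
  have hTp0 : 0 < T ^ p := by positivity
  rw [hsp, add_comm 1 p] at h2
  rw [add_comm 1 p] at hG
  have e : t ^ p / Real.Gamma (p + 1) * (Real.Gamma (p + 1) / T ^ p) = t ^ p / T ^ p := by
    field_simp
  rw [e, le_div_iff₀ hTp0] at h2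
  linarith

theorem ballBody_subset_superlevel_logConcave
    (g : EuclideanSpace ℝ (Fin n) → ℝ) (hg0 : ∀ x, 0 ≤ g x)
    (hint : Integrable g)
    (hlc : ∀ x y : EuclideanSpace ℝ (Fin n), ∀ a b : ℝ, 0 ≤ a → 0 ≤ b → a + b = 1 →
      g x ^ a * g y ^ b ≤ g (a • x + b • y))
    (hsup : ∀ x, g x ≤ g 0) (hgpos : 0 < g 0)
    (p t : ℝ) (hp : 0 < p) (ht : 0 < t) (htp : t < p / Real.exp 1) :
    (t / Real.Gamma (1 + p) ^ (1/p)) • ballBody g p ⊆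
      {x | Real.exp (-t) * g 0 ≤ g x} := by
  rintro _ ⟨x, hx, rfl⟩
  have hx : g 0 ≤ p * ∫ r in Set.Ioi (0:ℝ), r ^ (p - 1) * g (r • x) := hx
  have h := bb_one_dim (fun r => g (r • x) / g 0) (by simp [hgpos.ne'])
    (fun r => div_nonneg (hg0 _) hgpos.le) (fun r => (div_le_one hgpos).2 (hsup _)) ?_
    p t hp ht htp ?_
  · exact (le_div_iff₀ hgpos).1 h
  · intro r r' a b ha hb hab
    have := hlc (r • x) (r' • x) a b ha hb hab
    rw [smul_smul, smul_smul, ← add_smul] at this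
    rw [Real.div_rpow (hg0 _) hgpos.le, Real.div_rpow (hg0 _) hgpos.le, div_mul_div_comm,
      ← Real.rpow_add hgpos, hab, Real.rpow_one]
    gcongr
  · have e : ∫ r in Ioi (0:ℝ), r ^ (p - 1) * (g (r • x) / g 0) =
        (∫ r in Ioi (0:ℝ), r ^ (p - 1) * g (r • x)) / g 0 := by
      rw [← integral_div]
      simp only [mul_div_assoc]
    rw [e, ← mul_div_assoc, le_div_iff₀ hgpos, one_mul]
    exact hx
end
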